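/- (Proposition 2.) The quantity 2 ∫_{ℝ^d} ∫_{ℝ^d} K(x,y)² dN(m₀,Σ₀)(x) dN(m₀,Σ₀)(y) equals 2 det(I_d + 8σΣ₀)^{−1/2} − 4 det(V)^{−1/2} det(V + 4σΣ₀)^{−1/2} · { 1 + (1/2)σ²(tr[V^{−1}Σ₀])² + σ² tr[(V^{−1}Σ₀)²] + (1/2)σ²(tr[(V + 4σΣ₀)^{−1}Σ₀])² + σ² tr[((V + 4σΣ₀)^{−1}Σ₀)²] + σ tr[V^{−1}Σ₀] − σ tr[(V + 4σΣ₀)^{−1}Σ₀] − σ² tr[V^{−1}Σ₀] tr[(V + 4σΣ₀)^{−1}Σ₀] } + 2 det(V + 2σΣ₀)^{−1} · { 1 + 8σ² tr[((V + 2σΣ₀)^{−1}Σ₀)²] + 12σ⁴ (tr[((V + 2σΣ₀)^{−1}Σ₀)²])² + 24σ⁴ tr[((V + 2σΣ₀)^{−1}Σ₀)⁴] }. -/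

import Mathlib

open MeasureTheory Matrix Real

/-- The Gaussian probability measure `N(m, Σ)` on `ℝ^d`, given by its density
`(2π)^{-d/2} det(Σ)^{-1/2} exp(-(x-m)ᵀ Σ⁻¹ (x-m) / 2)` with respect to Lebesgue measure. -/
noncomputable def gaussN {d : ℕ} (m : Fin d → ℝ) (S : Matrix (Fin d) (Fin d) ℝ) :
    Measure (Fin d → ℝ) :=
  MeasureTheory.volume.withDensity fun x =>
    ENNReal.ofReal ((2 * π) ^ (-(d : ℝ) / 2) * S.det ^ (-(1 : ℝ) / 2) *
      Real.exp (-((x - m) ⬝ᵥ (S⁻¹ *ᵥ (x - m))) / 2))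

/-- `V = I_d + 2σΣ₀`. -/
noncomputable def Vm {d : ℕ} (σ : ℝ) (S : Matrix (Fin d) (Fin d) ℝ) :
    Matrix (Fin d) (Fin d) ℝ :=
  1 + (2 * σ) • S

/-- `B(x) = (x−m₀)(x−m₀)ᵀ − Σ₀`. -/
noncomputable def Bm {d : ℕ} (m₀ : Fin d → ℝ) (S : Matrix (Fin d) (Fin d) ℝ)
    (x : Fin d → ℝ) : Matrix (Fin d) (Fin d) ℝ :=
  vecMulVec (x - m₀) (x - m₀) - S

/-- `T₁(x,y) = exp(−σ‖x−y‖²)`. -/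
noncomputable def T1 {d : ℕ} (σ : ℝ) (x y : Fin d → ℝ) : ℝ :=
  Real.exp (-σ * ((x - y) ⬝ᵥ (x - y)))

/-- `T₂(x,y) = det(V)^{−1/2} exp(−σ(x−m₀)ᵀV⁻¹(x−m₀)) ·
(1 + 2σ(x−m₀)ᵀV⁻¹(y−m₀) + σ tr[V⁻¹(2σ(B(x)+Σ₀)V⁻¹ − I_d)B(y)])`. -/
noncomputable def T2 {d : ℕ} (σ : ℝ) (m₀ : Fin d → ℝ) (S : Matrix (Fin d) (Fin d) ℝ)
    (x y : Fin d → ℝ) : ℝ :=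
  (Vm σ S).det ^ (-(1 : ℝ) / 2) *
    Real.exp (-σ * ((x - m₀) ⬝ᵥ ((Vm σ S)⁻¹ *ᵥ (x - m₀)))) *
    (1 + 2 * σ * ((x - m₀) ⬝ᵥ ((Vm σ S)⁻¹ *ᵥ (y - m₀))) +
      σ * ((Vm σ S)⁻¹ * ((2 * σ) • (Bm m₀ S x + S) * (Vm σ S)⁻¹ - 1) * Bm m₀ S y).trace)

/-- `T₃(x,y) = T₂(y,x)`. -/
noncomputable def T3 {d : ℕ} (σ : ℝ) (m₀ : Fin d → ℝ) (S : Matrix (Fin d) (Fin d) ℝ)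
    (x y : Fin d → ℝ) : ℝ :=
  T2 σ m₀ S y x

/-- `T₄(x,y) = det(2V−I_d)^{−1/2} · (1 + σ tr[(2(x−m₀)(y−m₀)ᵀ − B(x) − B(y))(2V−I_d)⁻¹]
+ σ²(tr[B(x)(2V−I_d)⁻¹]·tr[B(y)(2V−I_d)⁻¹] + 2 tr[B(x)(2V−I_d)⁻¹B(y)(2V−I_d)⁻¹]))`. -/
noncomputable def T4 {d : ℕ} (σ : ℝ) (m₀ : Fin d → ℝ) (S : Matrix (Fin d) (Fin d) ℝ)
    (x y : Fin d → ℝ) : ℝ :=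
  ((2 : ℝ) • Vm σ S - 1).det ^ (-(1 : ℝ) / 2) *
    (1 + σ * (((2 : ℝ) • vecMulVec (x - m₀) (y - m₀) - Bm m₀ S x - Bm m₀ S y) *
        ((2 : ℝ) • Vm σ S - 1)⁻¹).trace +
      σ ^ 2 * ((Bm m₀ S x * ((2 : ℝ) • Vm σ S - 1)⁻¹).trace *
          (Bm m₀ S y * ((2 : ℝ) • Vm σ S - 1)⁻¹).trace +
        2 * (Bm m₀ S x * ((2 : ℝ) • Vm σ S - 1)⁻¹ *
          Bm m₀ S y * ((2 : ℝ) • Vm σ S - 1)⁻¹).trace))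

/-- `K(x,y) = T₁(x,y) − T₂(x,y) − T₃(x,y) + T₄(x,y)`. -/
noncomputable def Kf {d : ℕ} (σ : ℝ) (m₀ : Fin d → ℝ) (S : Matrix (Fin d) (Fin d) ℝ)
    (x y : Fin d → ℝ) : ℝ :=
  T1 σ x y - T2 σ m₀ S x y - T3 σ m₀ S x y + T4 σ m₀ S x y

open ProbabilityTheory

/-- The centered moments of a real Gaussian up to order four. -/
theorem integral_pow_gaussianReal_zero (s : NNReal) :
    ∫ x, x ^ 2 ∂(gaussianReal 0 s) = s ∧ ∫ x, x ^ 3 ∂(gaussianReal 0 s) = 0 ∧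
      ∫ x, x ^ 4 ∂(gaussianReal 0 s) = 3 * (s : ℝ) ^ 2 := by
  have key : ∀ n : ℕ, ∫ x, x ^ n ∂(gaussianReal 0 s) =
      iteratedDeriv n (fun t : ℝ => rexp (s * t ^ 2 / 2)) 0 := by
    intro n
    have h := iteratedDeriv_mgf_zero (X := id) (μ := gaussianReal 0 s)
      (by rw [integrableExpSet_id_gaussianReal]; simp) n
    rw [mgf_id_gaussianReal] at h
    simpa using h.symm
  have step : ∀ f g h : ℝ → ℝ, (∀ t, HasDerivAt f (g t) t) → (∀ t, h t = g t + f t * (s * t)) →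
      deriv (fun t => f t * rexp (s * t ^ 2 / 2)) = fun t => h t * rexp (s * t ^ 2 / 2) := by
    intro f g h hfg hh
    funext t
    have h1 : HasDerivAt (fun t : ℝ => (s : ℝ) * t ^ 2 / 2) (s * t) t :=
      (((hasDerivAt_pow 2 t).const_mul (s : ℝ)).div_const 2).congr_deriv (by push_cast; ring)
    rw [((hfg t).fun_mul h1.exp).deriv, hh]; ring
  have d0 : (fun t : ℝ => rexp (s * t ^ 2 / 2)) = fun t => 1 * rexp (s * t ^ 2 / 2) := by simp
  have d1 := step (fun _ => 1) (fun _ => 0) (fun t => s * t) (fun t => hasDerivAt_const t _)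
    (fun t => by ring)
  have d2 := step (fun t => s * t) (fun _ => s) (fun t => s + s ^ 2 * t ^ 2)
    (fun t => ((hasDerivAt_id' t).const_mul (s : ℝ)).congr_deriv (by ring)) (fun t => by ring)
  have d3 := step (fun t => s + s ^ 2 * t ^ 2) (fun t => s ^ 2 * (2 * t))
    (fun t => 3 * s ^ 2 * t + s ^ 3 * t ^ 3)
    (fun t => (((hasDerivAt_pow 2 t).const_mul ((s : ℝ) ^ 2)).const_add (s : ℝ)).congr_deriv
      (by push_cast; ring)) (fun t => by ring)
  have d4 := step (fun t => 3 * s ^ 2 * t + s ^ 3 * t ^ 3)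
    (fun t => 3 * s ^ 2 + s ^ 3 * (3 * t ^ 2))
    (fun t => 3 * s ^ 2 + s ^ 3 * (3 * t ^ 2) + (3 * s ^ 2 * t + s ^ 3 * t ^ 3) * (s * t))
    (fun t => (((hasDerivAt_id' t).const_mul (3 * (s : ℝ) ^ 2)).fun_add
      ((hasDerivAt_pow 3 t).const_mul ((s : ℝ) ^ 3))).congr_deriv (by push_cast; ring))
    (fun t => by ring)
  refine ⟨?_, ?_, ?_⟩
  · rw [key, d0, iteratedDeriv_succ', iteratedDeriv_succ', iteratedDeriv_zero, d1, d2]; simp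
  · rw [key, d0, iteratedDeriv_succ', iteratedDeriv_succ', iteratedDeriv_succ', iteratedDeriv_zero,
      d1, d2, d3]; simp
  · rw [key, d0, iteratedDeriv_succ', iteratedDeriv_succ', iteratedDeriv_succ',
      iteratedDeriv_succ', iteratedDeriv_zero, d1, d2, d3, d4]; simp

theorem integrable_pow_gaussianReal (m : ℝ) (s : NNReal) (n : ℕ) :
    Integrable (fun x : ℝ => x ^ n) (gaussianReal m s) := by
  have := (memLp_id_gaussianReal (μ := m) (v := s) n).integrable_norm_pow'
  rw [← integrable_norm_iff (by fun_prop)]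
  simpa using this

theorem integral_quartic_gaussianReal_zero (s : NNReal) (c₀ c₁ c₂ c₃ c₄ : ℝ) :
    ∫ x, (c₀ + c₁ * x + c₂ * x ^ 2 + c₃ * x ^ 3 + c₄ * x ^ 4) ∂(gaussianReal 0 s) =
      c₀ + c₂ * s + c₄ * (3 * (s : ℝ) ^ 2) := by
  obtain ⟨h2, h3, h4⟩ := integral_pow_gaussianReal_zero s
  have i := integrable_pow_gaussianReal 0 s
  have i1 : Integrable (fun x : ℝ => x) (gaussianReal 0 s) := by simpa using i 1
  have h1 : ∫ x : ℝ, x ∂(gaussianReal 0 s) = 0 := integral_id_gaussianReal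
  have j0 : Integrable (fun _ : ℝ => c₀) (gaussianReal 0 s) := integrable_const _
  have j1 : Integrable (fun x : ℝ => c₀ + c₁ * x) (gaussianReal 0 s) := j0.add (i1.const_mul _)
  have j2 : Integrable (fun x : ℝ => c₀ + c₁ * x + c₂ * x ^ 2) (gaussianReal 0 s) :=
    j1.add ((i 2).const_mul _)
  have j3 : Integrable (fun x : ℝ => c₀ + c₁ * x + c₂ * x ^ 2 + c₃ * x ^ 3) (gaussianReal 0 s) :=
    j2.add ((i 3).const_mul _)
  rw [integral_add j3 ((i 4).const_mul _), integral_add j2 ((i 3).const_mul _),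
    integral_add j1 ((i 2).const_mul _), integral_add j0 (i1.const_mul _)]
  rw [integral_const_mul c₁ (fun x => x), h1]
  simp only [integral_const_mul, h2, h3, h4]
  simp

theorem integral_quadratic_gaussianReal (m : ℝ) (s : NNReal) (c₀ c₁ c₂ : ℝ) :
    ∫ x, (c₀ + c₁ * x + c₂ * x ^ 2) ∂(gaussianReal m s) =
      c₀ + c₁ * m + c₂ * (m ^ 2 + s) := by
  have e : gaussianReal m s = (gaussianReal 0 s).map (· + m) := by
    rw [gaussianReal_map_add_const]; simp
  rw [e, integral_map (by fun_prop) (by fun_prop)]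
  have := integral_quartic_gaussianReal_zero s (c₀ + c₁ * m + c₂ * m ^ 2) (c₁ + 2 * c₂ * m) c₂ 0 0
  rw [show c₀ + c₁ * m + c₂ * (m ^ 2 + s) = c₀ + c₁ * m + c₂ * m ^ 2 + c₂ * s + 0 * (3 * (s : ℝ) ^ 2)
    by ring, ← this]
  congr 1; funext x; ring

/-- Completing the square under the standard Gaussian measure. -/
theorem integral_mul_exp_quadratic_gaussianReal (b c : ℝ) (hb : 0 ≤ b) (f : ℝ → ℝ) :
    ∫ x, f x * rexp (-b * x ^ 2 + c * x) ∂(gaussianReal 0 1) =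
      (1 + 2 * b) ^ (-(1 : ℝ) / 2) * rexp (c ^ 2 / (2 * (1 + 2 * b))) *
        ∫ x, f x ∂(gaussianReal (c / (1 + 2 * b)) (Real.toNNReal (1 / (1 + 2 * b)))) := by
  have hw : 0 < 1 + 2 * b := by linarith
  have hs : 0 < 1 / (1 + 2 * b) := by positivity
  rw [integral_gaussianReal_eq_integral_smul one_ne_zero,
    integral_gaussianReal_eq_integral_smul (by simpa using hw), ← integral_const_mul]
  congr 1; funext x
  simp only [gaussianPDFReal_def, smul_eq_mul, Real.coe_toNNReal _ hs.le, NNReal.coe_one]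
  have e1 : √(2 * π * (1 / (1 + 2 * b))) = √(2 * π) * (1 + 2 * b) ^ (-(1 : ℝ) / 2) := by
    rw [Real.sqrt_mul (by positivity), Real.sqrt_eq_rpow (1 / _), one_div, Real.inv_rpow hw.le,
      ← Real.rpow_neg hw.le]; norm_num
  have hr : 0 < (1 + 2 * b) ^ (-(1 : ℝ) / 2) := Real.rpow_pos_of_pos hw _
  have e2 : rexp (-(x - 0) ^ 2 / (2 * 1)) * rexp (-b * x ^ 2 + c * x) =
      rexp (c ^ 2 / (2 * (1 + 2 * b))) *
        rexp (-(x - c / (1 + 2 * b)) ^ 2 / (2 * (1 / (1 + 2 * b)))) := by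
    rw [← Real.exp_add, ← Real.exp_add]; congr 1; field_simp; ring
  rw [e1, mul_one]
  calc _ = (√(2 * π))⁻¹ * (rexp (-(x - 0) ^ 2 / (2 * 1)) * rexp (-b * x ^ 2 + c * x)) * f x := by
        ring
    _ = _ := by rw [e2]; field_simp

/-- The normalized Hermite polynomials of degree at most two. -/
noncomputable def hermiteN (n : Fin 3) (x : ℝ) : ℝ :=
  ![1, x, (x ^ 2 - 1) / √2] n

/-- The Hermite coefficients in one variable of the Gaussian kernel `exp(-a(u-v)²)`. -/
noncomputable def hermiteCoeff (a : ℝ) (n : Fin 3) (x : ℝ) : ℝ :=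
  (1 + 2 * a) ^ (-(1 : ℝ) / 2) * rexp (-(a / (1 + 2 * a)) * x ^ 2) *
    ![1, 2 * (a / (1 + 2 * a)) * x,
      (4 * (a / (1 + 2 * a)) ^ 2 * x ^ 2 - 2 * (a / (1 + 2 * a))) / √2] n

/-- The Hermite coefficients in both variables of the Gaussian kernel `exp(-a(u-v)²)`. -/
noncomputable def hermiteCoeff₂ (a : ℝ) (m n : Fin 3) : ℝ :=
  (1 + 4 * a) ^ (-(1 : ℝ) / 2) *
    !![1, 0, -2 * (a / (1 + 4 * a)) / √2; 0, 2 * (a / (1 + 4 * a)), 0;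
      -2 * (a / (1 + 4 * a)) / √2, 0, 6 * (a / (1 + 4 * a)) ^ 2] m n

theorem measurable_hermiteN (n : Fin 3) : Measurable (hermiteN n) := by
  unfold hermiteN; fin_cases n <;> simp <;> fun_prop

theorem measurable_hermiteCoeff (a : ℝ) (n : Fin 3) : Measurable (hermiteCoeff a n) := by
  unfold hermiteCoeff; fin_cases n <;> simp <;> fun_prop

theorem integral_hermiteN_mul (m n : Fin 3) :
    ∫ x, hermiteN m x * hermiteN n x ∂(gaussianReal 0 1) = if m = n then 1 else 0 := by
  have h := integral_quartic_gaussianReal_zero 1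
  have h2 : √2 * √2 = 2 := Real.mul_self_sqrt (by norm_num)
  have key : ∀ c₀ c₁ c₂ c₃ c₄ : ℝ, (∀ x, hermiteN m x * hermiteN n x =
      c₀ + c₁ * x + c₂ * x ^ 2 + c₃ * x ^ 3 + c₄ * x ^ 4) →
      c₀ + c₂ + c₄ * 3 = (if m = n then 1 else 0) →
      ∫ x, hermiteN m x * hermiteN n x ∂(gaussianReal 0 1) = if m = n then 1 else 0 := by
    intro c₀ c₁ c₂ c₃ c₄ hx hc
    simp_rw [hx, h, ← hc]; simp
  fin_cases m <;> fin_cases n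
  · exact key 1 0 0 0 0 (by intro x; simp [hermiteN]) (by simp)
  · exact key 0 1 0 0 0 (by intro x; simp [hermiteN]) (by simp)
  · exact key (-1 / √2) 0 (1 / √2) 0 0 (by intro x; simp [hermiteN]; ring) (by simp; ring)
  · exact key 0 1 0 0 0 (by intro x; simp [hermiteN]) (by simp)
  · exact key 0 0 1 0 0 (by intro x; simp [hermiteN]; ring) (by simp)
  · exact key 0 (-1 / √2) 0 (1 / √2) 0 (by intro x; simp [hermiteN]; ring) (by simp)
  · exact key (-1 / √2) 0 (1 / √2) 0 0 (by intro x; simp [hermiteN]; ring) (by simp; ring)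
  · exact key 0 (-1 / √2) 0 (1 / √2) 0 (by intro x; simp [hermiteN]; ring) (by simp)
  · refine key (1 / 2) 0 (-1) 0 (1 / 2) ?_ (by simp; ring)
    intro x; simp [hermiteN]; rw [div_mul_div_comm, h2]; ring

theorem integral_exp_neg_sq_mul_hermiteN {a : ℝ} (ha : 0 ≤ a) (n : Fin 3) (u : ℝ) :
    ∫ v, rexp (-a * (u - v) ^ 2) * hermiteN n v ∂(gaussianReal 0 1) = hermiteCoeff a n u := by
  have hw : 0 < 1 + 2 * a := by linarith
  have e : ∀ v, rexp (-a * (u - v) ^ 2) * hermiteN n v =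
      rexp (-a * u ^ 2) * (hermiteN n v * rexp (-a * v ^ 2 + 2 * a * u * v)) := by
    intro v
    rw [mul_left_comm, ← Real.exp_add, mul_comm]; congr 2; ring
  have e2 : rexp (-a * u ^ 2) * rexp ((2 * a * u) ^ 2 / (2 * (1 + 2 * a))) =
      rexp (-(a / (1 + 2 * a)) * u ^ 2) := by
    rw [← Real.exp_add]; congr 1; field_simp; ring
  simp_rw [e]
  rw [integral_const_mul, integral_mul_exp_quadratic_gaussianReal _ _ ha, hermiteCoeff, ← e2]
  have h := integral_quadratic_gaussianReal (2 * a * u / (1 + 2 * a))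
    (Real.toNNReal (1 / (1 + 2 * a)))
  rw [Real.coe_toNNReal _ (by positivity)] at h
  have key : ∀ c₀ c₁ c₂ : ℝ, (∀ x, hermiteN n x = c₀ + c₁ * x + c₂ * x ^ 2) →
      ∫ x, hermiteN n x ∂(gaussianReal (2 * a * u / (1 + 2 * a)) (Real.toNNReal (1 / (1 + 2 * a))))
      = c₀ + c₁ * (2 * a * u / (1 + 2 * a)) +
        c₂ * ((2 * a * u / (1 + 2 * a)) ^ 2 + 1 / (1 + 2 * a)) := by
    intro c₀ c₁ c₂ hx
    simp_rw [hx, h]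
  fin_cases n
  · rw [key 1 0 0 (by intro x; simp [hermiteN])]; simp; ring
  · rw [key 0 1 0 (by intro x; simp [hermiteN])]; simp; ring
  · rw [key (-1 / √2) 0 (1 / √2) (by intro x; simp [hermiteN]; ring)]; simp; field_simp; ring

theorem integral_hermiteCoeff_mul_hermiteN {a : ℝ} (ha : 0 ≤ a) (m n : Fin 3) :
    ∫ x, hermiteCoeff a m x * hermiteN n x ∂(gaussianReal 0 1) = hermiteCoeff₂ a m n := by
  have hw : 0 < 1 + 2 * a := by linarith
  have hw4 : 0 < 1 + 4 * a := by linarith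
  have hp : 0 ≤ a / (1 + 2 * a) := by positivity
  have h2 : √2 * √2 = 2 := Real.mul_self_sqrt (by norm_num)
  have hs2 : √2 ^ 2 = 2 := Real.sq_sqrt (by norm_num)
  have es : 1 / (1 + 2 * (a / (1 + 2 * a))) = (1 + 2 * a) / (1 + 4 * a) := by field_simp; ring
  have e0 : (1 + 2 * a) ^ (-(1 : ℝ) / 2) * (1 + 2 * (a / (1 + 2 * a))) ^ (-(1 : ℝ) / 2) =
      (1 + 4 * a) ^ (-(1 : ℝ) / 2) := by
    rw [← Real.mul_rpow hw.le (by positivity)]; congr 1; field_simp; ring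
  have key : ∀ c₀ c₁ c₂ c₃ c₄ : ℝ, (∀ x, hermiteCoeff a m x * hermiteN n x =
      (1 + 2 * a) ^ (-(1 : ℝ) / 2) * ((c₀ + c₁ * x + c₂ * x ^ 2 + c₃ * x ^ 3 + c₄ * x ^ 4) *
        rexp (-(a / (1 + 2 * a)) * x ^ 2 + 0 * x))) →
      ∫ x, hermiteCoeff a m x * hermiteN n x ∂(gaussianReal 0 1) =
        (1 + 4 * a) ^ (-(1 : ℝ) / 2) * (c₀ + c₂ * ((1 + 2 * a) / (1 + 4 * a)) +
          c₄ * (3 * ((1 + 2 * a) / (1 + 4 * a)) ^ 2)) := by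
    intro c₀ c₁ c₂ c₃ c₄ hx
    simp_rw [hx]
    rw [integral_const_mul, integral_mul_exp_quadratic_gaussianReal _ _ hp, zero_div,
      integral_quartic_gaussianReal_zero, Real.coe_toNNReal _ (by positivity), es, ← e0]
    simp; ring
  set p := a / (1 + 2 * a) with hpdef
  have key' : ∀ c₀ c₁ c₂ c₃ c₄ : ℝ, (∀ x, ![1, 2 * p * x, (4 * p ^ 2 * x ^ 2 - 2 * p) / √2] m *
        hermiteN n x = c₀ + c₁ * x + c₂ * x ^ 2 + c₃ * x ^ 3 + c₄ * x ^ 4) →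
      c₀ + c₂ * ((1 + 2 * a) / (1 + 4 * a)) + c₄ * (3 * ((1 + 2 * a) / (1 + 4 * a)) ^ 2) =
      !![1, 0, -2 * (a / (1 + 4 * a)) / √2; 0, 2 * (a / (1 + 4 * a)), 0;
      -2 * (a / (1 + 4 * a)) / √2, 0, 6 * (a / (1 + 4 * a)) ^ 2] m n →
      ∫ x, hermiteCoeff a m x * hermiteN n x ∂(gaussianReal 0 1) = hermiteCoeff₂ a m n := by
    intro c₀ c₁ c₂ c₃ c₄ hx hc
    rw [key c₀ c₁ c₂ c₃ c₄, hermiteCoeff₂, hc]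
    intro x
    rw [← hx, hermiteCoeff, zero_mul, add_zero, ← hpdef]
    ring
  fin_cases m <;> fin_cases n
  · exact key' 1 0 0 0 0 (by intro x; simp [hermiteN]) (by simp)
  · exact key' 0 1 0 0 0 (by intro x; simp [hermiteN]) (by simp)
  · refine key' (-1 / √2) 0 (1 / √2) 0 0 (by intro x; simp [hermiteN]; ring) ?_
    simp; field_simp; ring
  · exact key' 0 (2 * p) 0 0 0 (by intro x; simp [hermiteN]) (by simp)
  · refine key' 0 0 (2 * p) 0 0 (by intro x; simp [hermiteN]; ring) ?_
    simp [hpdef]; field_simp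
  · exact key' 0 (-2 * p / √2) 0 (2 * p / √2) 0 (by intro x; simp [hermiteN]; ring) (by simp)
  · refine key' (-2 * p / √2) 0 (4 * p ^ 2 / √2) 0 0 (by intro x; simp [hermiteN]; ring) ?_
    simp [hpdef]; field_simp; ring
  · exact key' 0 (-2 * p / √2) 0 (4 * p ^ 2 / √2) 0 (by intro x; simp [hermiteN]; ring) (by simp)
  · refine key' p 0 (-p - 2 * p ^ 2) 0 (2 * p ^ 2) ?_ ?_
    · intro x; simp [hermiteN]; rw [div_mul_div_comm, h2]; ring
    · simp [hpdef]; field_simp; ring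

theorem integral_hermiteCoeff_sq {a : ℝ} (ha : 0 ≤ a) (n : Fin 3) :
    ∫ x, hermiteCoeff a n x ^ 2 ∂(gaussianReal 0 1) =
      (1 + 2 * a) ^ (-(1 : ℝ) / 2) * (1 + 6 * a) ^ (-(1 : ℝ) / 2) *
        ![1, a / (1 + 2 * a) - a / (1 + 6 * a),
          3 / 2 * (a / (1 + 2 * a)) ^ 2 - a / (1 + 2 * a) * (a / (1 + 6 * a)) +
            3 / 2 * (a / (1 + 6 * a)) ^ 2] n := by
  have hw : 0 < 1 + 2 * a := by linarith
  have hw4 : 0 < 1 + 6 * a := by linarith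
  have hp : 0 ≤ 2 * (a / (1 + 2 * a)) := by positivity
  have hs2 : √2 ^ 2 = 2 := Real.sq_sqrt (by norm_num)
  have es : 1 / (1 + 2 * (2 * (a / (1 + 2 * a)))) = (1 + 2 * a) / (1 + 6 * a) := by
    field_simp; ring
  have e0 : (1 + 2 * a) ^ (-(1 : ℝ) / 2) * (1 + 2 * (2 * (a / (1 + 2 * a)))) ^ (-(1 : ℝ) / 2) =
      (1 + 6 * a) ^ (-(1 : ℝ) / 2) := by
    rw [← Real.mul_rpow hw.le (by positivity)]; congr 1; field_simp; ring
  set p := a / (1 + 2 * a) with hpdef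
  have key : ∀ c₀ c₁ c₂ c₃ c₄ : ℝ, (∀ x, ![1, 2 * p * x, (4 * p ^ 2 * x ^ 2 - 2 * p) / √2] n ^ 2 =
      c₀ + c₁ * x + c₂ * x ^ 2 + c₃ * x ^ 3 + c₄ * x ^ 4) →
      ∫ x, hermiteCoeff a n x ^ 2 ∂(gaussianReal 0 1) =
        (1 + 2 * a) ^ (-(1 : ℝ) / 2) * (1 + 6 * a) ^ (-(1 : ℝ) / 2) *
          (c₀ + c₂ * ((1 + 2 * a) / (1 + 6 * a)) +
          c₄ * (3 * ((1 + 2 * a) / (1 + 6 * a)) ^ 2)) := by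
    intro c₀ c₁ c₂ c₃ c₄ hx
    have hx' : ∀ x, hermiteCoeff a n x ^ 2 = ((1 + 2 * a) ^ (-(1 : ℝ) / 2)) ^ 2 *
        ((c₀ + c₁ * x + c₂ * x ^ 2 + c₃ * x ^ 3 + c₄ * x ^ 4) *
          rexp (-(2 * p) * x ^ 2 + 0 * x)) := by
      intro x
      rw [← hx, hermiteCoeff, mul_pow, mul_pow, ← Real.exp_nat_mul, ← hpdef]
      push_cast
      rw [show 2 * (-p * x ^ 2) = -(2 * p) * x ^ 2 + 0 * x by ring]; ring
    simp_rw [hx']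
    rw [integral_const_mul, integral_mul_exp_quadratic_gaussianReal _ _ hp, zero_div,
      integral_quartic_gaussianReal_zero, Real.coe_toNNReal _ (by positivity), es, ← e0]
    simp; ring
  fin_cases n
  · rw [key 1 0 0 0 0 (by intro x; simp)]; simp
  · rw [key 0 0 (4 * p ^ 2) 0 0 (by intro x; simp; ring)]
    congr 1; simp [hpdef]; field_simp; ring
  · rw [key (2 * p ^ 2) 0 (-8 * p ^ 3) 0 (8 * p ^ 4)
      (by intro x; simp; rw [div_pow, hs2]; ring)]
    congr 1; simp [hpdef]; field_simp; ring

theorem integral_integral_exp_neg_sq_sq {a : ℝ} (ha : 0 ≤ a) :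
    ∫ u, ∫ v, rexp (-a * (u - v) ^ 2) ^ 2 ∂(gaussianReal 0 1) ∂(gaussianReal 0 1) =
      (1 + 8 * a) ^ (-(1 : ℝ) / 2) := by
  have e : ∀ u v : ℝ, rexp (-a * (u - v) ^ 2) ^ 2 =
      rexp (-(2 * a) * (u - v) ^ 2) * hermiteN 0 v := by
    intro u v
    rw [← Real.exp_nat_mul]; simp [hermiteN]; ring
  simp_rw [e, integral_exp_neg_sq_mul_hermiteN (show 0 ≤ 2 * a by linarith)]
  have := integral_hermiteCoeff_mul_hermiteN (show 0 ≤ 2 * a by linarith) 0 0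
  simp only [hermiteN, hermiteCoeff₂] at this
  simpa [← mul_assoc, show (4 : ℝ) * 2 = 8 by norm_num] using this

theorem memLp_quadratic_gaussianReal (c₀ c₁ c₂ : ℝ) :
    MemLp (fun x : ℝ => c₀ + c₁ * x + c₂ * x ^ 2) 2 (gaussianReal 0 1) := by
  have i : ∀ n : ℕ, MemLp (fun x : ℝ => x ^ n) 2 (gaussianReal 0 1) := by
    intro n
    rw [memLp_two_iff_integrable_sq (by fun_prop)]
    simpa [← pow_mul] using integrable_pow_gaussianReal 0 1 (n * 2)
  have i1 : MemLp (fun x : ℝ => x) 2 (gaussianReal 0 1) := by simpa using i 1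
  exact ((memLp_const c₀).add (i1.const_mul c₁)).add ((i 2).const_mul c₂)

theorem memLp_hermiteN (n : Fin 3) : MemLp (hermiteN n) 2 (gaussianReal 0 1) := by
  fin_cases n
  · convert memLp_quadratic_gaussianReal 1 0 0 using 1; funext x; simp [hermiteN]
  · convert memLp_quadratic_gaussianReal 0 1 0 using 1; funext x; simp [hermiteN]
  · convert memLp_quadratic_gaussianReal (-1 / √2) 0 (1 / √2) using 1
    funext x; simp [hermiteN]; ring

theorem memLp_hermiteCoeff {a : ℝ} (ha : 0 ≤ a) (n : Fin 3) :
    MemLp (hermiteCoeff a n) 2 (gaussianReal 0 1) := by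
  have hw : 0 < 1 + 2 * a := by linarith
  have hp : 0 ≤ a / (1 + 2 * a) := by positivity
  have key : ∀ c₀ c₁ c₂ : ℝ, (∀ x, ![1, 2 * (a / (1 + 2 * a)) * x,
      (4 * (a / (1 + 2 * a)) ^ 2 * x ^ 2 - 2 * (a / (1 + 2 * a))) / √2] n =
      c₀ + c₁ * x + c₂ * x ^ 2) → MemLp (hermiteCoeff a n) 2 (gaussianReal 0 1) := by
    intro c₀ c₁ c₂ hx
    refine (memLp_quadratic_gaussianReal c₀ c₁ c₂).of_le_mul
      (c := (1 + 2 * a) ^ (-(1 : ℝ) / 2)) (measurable_hermiteCoeff a n).aestronglyMeasurable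
      (Filter.Eventually.of_forall fun x => ?_)
    rw [hermiteCoeff, hx, norm_mul, norm_mul, Real.norm_of_nonneg (Real.rpow_nonneg hw.le _),
      Real.norm_of_nonneg (Real.exp_pos _).le]
    refine mul_le_mul_of_nonneg_right (mul_le_of_le_one_right (Real.rpow_nonneg hw.le _) ?_)
      (norm_nonneg _)
    rw [Real.exp_le_one_iff, neg_mul]
    exact neg_nonpos.mpr (by positivity)
  fin_cases n
  · exact key 1 0 0 (by simp)
  · exact key 0 (2 * (a / (1 + 2 * a))) 0 (by simp)
  · exact key (-2 * (a / (1 + 2 * a)) / √2) 0 (4 * (a / (1 + 2 * a)) ^ 2 / √2)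
      (by intro x; simp; ring)

theorem MeasureTheory.MemLp.mul_prod_two {X : Type*} [MeasurableSpace X] {μ : Measure X}
    [SFinite μ] {f g : X → ℝ} (hf : MemLp f 2 μ) (hg : MemLp g 2 μ) :
    MemLp (fun z : X × X => f z.1 * g z.2) 2 (μ.prod μ) := by
  have hm : AEStronglyMeasurable (fun z : X × X => f z.1 * g z.2) (μ.prod μ) :=
    hf.1.comp_fst.mul hg.1.comp_snd
  rw [memLp_two_iff_integrable_sq hm]
  simp_rw [mul_pow]
  exact hf.integrable_sq.mul_prod hg.integrable_sq

theorem integral_mul_sub_of_memLp {Y : Type*} [MeasurableSpace Y] {ν : Measure Y} {f g h : Y → ℝ}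
    (hf : MemLp f 2 ν) (hg : MemLp g 2 ν) (hh : MemLp h 2 ν) :
    ∫ z, f z * (g z - h z) ∂ν = ∫ z, f z * g z ∂ν - ∫ z, f z * h z ∂ν := by
  simp_rw [mul_sub]
  exact integral_sub (hf.integrable_mul hg) (hf.integrable_mul hh)

theorem integral_sub_sub_sq_of_memLp {Y : Type*} [MeasurableSpace Y] {ν : Measure Y}
    {t a b e : Y → ℝ} (ht : MemLp t 2 ν) (ha : MemLp a 2 ν) (hb : MemLp b 2 ν)
    (he : MemLp e 2 ν) :
    ∫ z, (t z - a z - b z + e z) ^ 2 ∂ν =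
      ∫ z, t z * t z ∂ν + ∫ z, a z * a z ∂ν + ∫ z, b z * b z ∂ν + ∫ z, e z * e z ∂ν -
      2 * ∫ z, t z * a z ∂ν - 2 * ∫ z, t z * b z ∂ν + 2 * ∫ z, t z * e z ∂ν +
      2 * ∫ z, a z * b z ∂ν - 2 * ∫ z, a z * e z ∂ν - 2 * ∫ z, b z * e z ∂ν := by
  have hta : MemLp (fun z => t z - a z) 2 ν := ht.sub ha
  have hbe : MemLp (fun z => b z - e z) 2 ν := hb.sub he
  have h0 : ∀ z, (t z - a z - b z + e z) ^ 2 =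
      ((t z - a z) - (b z - e z)) * ((t z - a z) - (b z - e z)) := fun z => by ring
  simp_rw [h0]
  rw [integral_mul_sub_of_memLp (f := fun z => t z - a z - (b z - e z)) (hta.sub hbe) hta hbe,
    integral_mul_sub_of_memLp (f := fun z => t z - a z - (b z - e z)) (hta.sub hbe) ht ha,
    integral_mul_sub_of_memLp (f := fun z => t z - a z - (b z - e z)) (hta.sub hbe) hb he]
  have h1 : ∀ p : Y → ℝ, MemLp p 2 ν → ∫ z, (t z - a z - (b z - e z)) * p z ∂ν =
      ∫ z, t z * p z ∂ν - ∫ z, a z * p z ∂ν - (∫ z, b z * p z ∂ν - ∫ z, e z * p z ∂ν) := by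
    intro p hp
    simp_rw [mul_comm _ (p _)]
    rw [integral_mul_sub_of_memLp hp hta hbe, integral_mul_sub_of_memLp hp ht ha,
      integral_mul_sub_of_memLp hp hb he]
  rw [h1 t ht, h1 a ha, h1 b hb, h1 e he]
  have hc : ∀ p q : Y → ℝ, ∫ z, p z * q z ∂ν = ∫ z, q z * p z ∂ν := by
    intro p q; simp_rw [mul_comm]
  rw [hc a t, hc b t, hc b a, hc e t, hc e a, hc e b]
  ring

theorem integral_mul_sum_of_memLp {Y ι : Type*} [MeasurableSpace Y] {ν : Measure Y} {f : Y → ℝ}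
    {g : ι → Y → ℝ} (A : Finset ι) (hf : MemLp f 2 ν) (hg : ∀ i, MemLp (g i) 2 ν) :
    ∫ z, f z * ∑ i ∈ A, g i z ∂ν = ∑ i ∈ A, ∫ z, f z * g i z ∂ν := by
  simp_rw [Finset.mul_sum]
  exact integral_finsetSum _ fun i _ => hf.integrable_mul (hg i)

/-- The squared norm of a symmetric kernel after projecting out, in both variables, the span of a
finite orthonormal family. -/
theorem integral_sq_kernel_sub_projections {X ι : Type*} [MeasurableSpace X] [DecidableEq ι]
    (μ : Measure X) [IsProbabilityMeasure μ] (A : Finset ι) (T : X → X → ℝ)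
    (hT : MemLp (fun z : X × X => T z.1 z.2) 2 (μ.prod μ)) (hTs : ∀ x y, T x y = T y x)
    (F H : ι → X → ℝ) (hF : ∀ i, MemLp (F i) 2 μ) (hH : ∀ i, MemLp (H i) 2 μ)
    (hHH : ∀ i j, ∫ x, H i x * H j x ∂μ = if i = j then 1 else 0)
    (hTH : ∀ i x, ∫ y, T x y * H i y ∂μ = F i x) (C : ι → ι → ℝ)
    (hC : ∀ i j, ∫ x, F i x * H j x ∂μ = C i j) :
    ∫ y, ∫ x, (T x y - (∑ i ∈ A, F i x * H i y) - (∑ i ∈ A, H i x * F i y) +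
        ∑ i ∈ A, ∑ j ∈ A, C i j * (H i x * H j y)) ^ 2 ∂μ ∂μ =
      ∫ x, ∫ y, T x y ^ 2 ∂μ ∂μ - 2 * ∑ i ∈ A, ∫ x, F i x ^ 2 ∂μ +
        ∑ i ∈ A, ∑ j ∈ A, C i j ^ 2 := by
  have hTmul : ∀ (f : X → ℝ) i, MemLp f 2 μ →
      ∫ z, T z.1 z.2 * (f z.1 * H i z.2) ∂(μ.prod μ) = ∫ x, F i x * f x ∂μ := by
    intro f i hf
    refine (integral_prod _ (hT.integrable_mul (hf.mul_prod_two (hH i)))).trans ?_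
    congr 1; funext x
    rw [← hTH i x, ← integral_mul_const]
    congr 1; funext y; simp only [Pi.mul_apply]; ring
  have hpp : ∀ f g f' g' : X → ℝ, ∫ z, (f z.1 * g z.2) * (f' z.1 * g' z.2) ∂(μ.prod μ) =
      (∫ x, f x * f' x ∂μ) * ∫ x, g x * g' x ∂μ := by
    intro f g f' g'
    rw [← integral_prod_mul]
    congr 1; funext z; ring
  have hCs : ∀ i j, C i j = C j i := by
    intro i j
    rw [← hC, ← hC, ← hTmul _ _ (hH j), ← hTmul _ _ (hH i), ← integral_prod_swap]
    congr 1; funext z; simp only [Prod.fst_swap, Prod.snd_swap]; rw [hTs]; ring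
  have hTmul' : ∀ i, ∫ z, T z.1 z.2 * (H i z.1 * F i z.2) ∂(μ.prod μ) = ∫ x, F i x * F i x ∂μ := by
    intro i
    rw [← hTmul _ _ (hF i), ← integral_prod_swap]
    congr 1; funext z; simp only [Prod.fst_swap, Prod.snd_swap]; rw [hTs]; ring
  have hFH := fun i => (hF i).mul_prod_two (hH i)
  have hHF := fun i => (hH i).mul_prod_two (hF i)
  have hE : ∀ i j, MemLp (fun z : X × X => C i j * (H i z.1 * H j z.2)) 2 (μ.prod μ) :=
    fun i j => ((hH i).mul_prod_two (hH j)).const_mul (C i j)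
  have hE' : ∀ i, MemLp (fun z : X × X => ∑ j ∈ A, C i j * (H i z.1 * H j z.2)) 2 (μ.prod μ) :=
    fun i => memLp_finsetSum A fun j _ => hE i j
  have ha : MemLp (fun z : X × X => ∑ i ∈ A, F i z.1 * H i z.2) 2 (μ.prod μ) :=
    memLp_finsetSum A fun i _ => hFH i
  have hb : MemLp (fun z : X × X => ∑ i ∈ A, H i z.1 * F i z.2) 2 (μ.prod μ) :=
    memLp_finsetSum A fun i _ => hHF i
  have he : MemLp (fun z : X × X => ∑ i ∈ A, ∑ j ∈ A, C i j * (H i z.1 * H j z.2)) 2 (μ.prod μ) :=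
    memLp_finsetSum A fun i _ => hE' i
  have hE2 : ∀ p : X × X → ℝ, MemLp p 2 (μ.prod μ) →
      ∫ z, p z * ∑ i ∈ A, ∑ j ∈ A, C i j * (H i z.1 * H j z.2) ∂(μ.prod μ) =
      ∑ i ∈ A, ∑ j ∈ A, C i j * ∫ z, p z * (H i z.1 * H j z.2) ∂(μ.prod μ) := by
    intro p hp
    rw [integral_mul_sum_of_memLp A hp hE']
    refine Finset.sum_congr rfl fun i _ => ?_
    rw [integral_mul_sum_of_memLp A hp (hE i)]
    refine Finset.sum_congr rfl fun j _ => ?_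
    rw [← integral_const_mul]
    congr 1; funext z; ring
  have hcomm : ∀ p q : X × X → ℝ, ∫ z, p z * q z ∂(μ.prod μ) = ∫ z, q z * p z ∂(μ.prod μ) := by
    intro p q; simp_rw [mul_comm]
  have haH : ∀ i j, i ∈ A → j ∈ A → ∫ z, (∑ k ∈ A, F k z.1 * H k z.2) * (H i z.1 * H j z.2)
      ∂(μ.prod μ) = C i j := by
    intro i j hi hj
    rw [hcomm, integral_mul_sum_of_memLp A ((hH i).mul_prod_two (hH j)) hFH]
    simp_rw [hpp, hHH, mul_ite, mul_one, mul_zero]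
    rw [Finset.sum_ite_eq, if_pos hj, hCs, ← hC]
    simp_rw [mul_comm]
  have hbH : ∀ i j, i ∈ A → j ∈ A → ∫ z, (∑ k ∈ A, H k z.1 * F k z.2) * (H i z.1 * H j z.2)
      ∂(μ.prod μ) = C i j := by
    intro i j hi hj
    rw [hcomm, integral_mul_sum_of_memLp A ((hH i).mul_prod_two (hH j)) hHF]
    simp_rw [hpp, hHH, ite_mul, one_mul, zero_mul]
    rw [Finset.sum_ite_eq, if_pos hi, ← hC]
    simp_rw [mul_comm]
  have heH : ∀ i j, i ∈ A → j ∈ A → ∫ z, (∑ k ∈ A, ∑ l ∈ A, C k l * (H k z.1 * H l z.2)) *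
      (H i z.1 * H j z.2) ∂(μ.prod μ) = C i j := by
    intro i j hi hj
    rw [hcomm, hE2 _ ((hH i).mul_prod_two (hH j))]
    simp_rw [hpp, hHH]
    simp [hi, hj]
  have hTH' : ∀ i j, ∫ z, T z.1 z.2 * (H i z.1 * H j z.2) ∂(μ.prod μ) = C i j := by
    intro i j
    rw [hTmul _ _ (hH i), hC, hCs]
  have hsum : ∀ p : X × X → ℝ, MemLp p 2 (μ.prod μ) →
      (∀ i j, i ∈ A → j ∈ A → ∫ z, p z * (H i z.1 * H j z.2) ∂(μ.prod μ) = C i j) →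
      ∫ z, p z * ∑ i ∈ A, ∑ j ∈ A, C i j * (H i z.1 * H j z.2) ∂(μ.prod μ) =
        ∑ i ∈ A, ∑ j ∈ A, C i j ^ 2 := by
    intro p hp h
    rw [hE2 p hp]
    exact Finset.sum_congr rfl fun i hi => Finset.sum_congr rfl fun j hj => by
      rw [h i j hi hj, sq]
  have hK := ((hT.sub ha).sub hb).add he
  have main := integral_sub_sub_sq_of_memLp hT ha hb he
  have haa : ∫ z : X × X, (∑ i ∈ A, F i z.1 * H i z.2) * (∑ i ∈ A, F i z.1 * H i z.2) ∂(μ.prod μ) =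
      ∑ i ∈ A, ∫ x, F i x ^ 2 ∂μ := by
    rw [integral_mul_sum_of_memLp A ha hFH]
    refine Finset.sum_congr rfl fun i hi => ?_
    rw [hcomm, integral_mul_sum_of_memLp A (hFH i) hFH]
    simp_rw [hpp, hHH, mul_ite, mul_one, mul_zero]
    rw [Finset.sum_ite_eq, if_pos hi]
    simp_rw [sq]
  have hbb : ∫ z : X × X, (∑ i ∈ A, H i z.1 * F i z.2) * (∑ i ∈ A, H i z.1 * F i z.2) ∂(μ.prod μ) =
      ∑ i ∈ A, ∫ x, F i x ^ 2 ∂μ := by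
    rw [integral_mul_sum_of_memLp A hb hHF]
    refine Finset.sum_congr rfl fun i hi => ?_
    rw [hcomm, integral_mul_sum_of_memLp A (hHF i) hHF]
    simp_rw [hpp, hHH, ite_mul, one_mul, zero_mul]
    rw [Finset.sum_ite_eq, if_pos hi]
    simp_rw [sq]
  have hab : ∫ z : X × X, (∑ i ∈ A, F i z.1 * H i z.2) * (∑ i ∈ A, H i z.1 * F i z.2) ∂(μ.prod μ) =
      ∑ i ∈ A, ∑ j ∈ A, C i j ^ 2 := by
    rw [integral_mul_sum_of_memLp A ha hHF]
    refine Finset.sum_congr rfl fun i hi => ?_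
    rw [hcomm, integral_mul_sum_of_memLp A (hHF i) hFH]
    refine Finset.sum_congr rfl fun j hj => ?_
    have : ∫ x, H i x * F j x ∂μ = C j i := by rw [← hC]; simp_rw [mul_comm]
    rw [hpp, this, hC, hCs, sq]
  have hta : ∫ z : X × X, T z.1 z.2 * (∑ i ∈ A, F i z.1 * H i z.2) ∂(μ.prod μ) =
      ∑ i ∈ A, ∫ x, F i x ^ 2 ∂μ := by
    rw [integral_mul_sum_of_memLp A hT hFH]
    refine Finset.sum_congr rfl fun i hi => ?_
    rw [hTmul _ _ (hF i)]
    simp_rw [sq]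
  have htb : ∫ z : X × X, T z.1 z.2 * (∑ i ∈ A, H i z.1 * F i z.2) ∂(μ.prod μ) =
      ∑ i ∈ A, ∫ x, F i x ^ 2 ∂μ := by
    rw [integral_mul_sum_of_memLp A hT hHF]
    refine Finset.sum_congr rfl fun i hi => ?_
    rw [hTmul']
    simp_rw [sq]
  have htt : ∫ z : X × X, T z.1 z.2 * T z.1 z.2 ∂(μ.prod μ) = ∫ x, ∫ y, T x y ^ 2 ∂μ ∂μ := by
    simp_rw [← sq]
    exact integral_prod _ hT.integrable_sq
  rw [haa, hbb, hab, hta, htb, htt, hsum _ hT fun i j _ _ => hTH' i j, hsum _ ha haH,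
    hsum _ hb hbH, hsum _ he heH] at main
  have hswap := integral_prod_symm _ hK.integrable_sq
  simp only [Pi.add_apply, Pi.sub_apply] at hswap
  rw [main] at hswap
  rw [← hswap]
  ring

theorem Fin.sum_fin_succ_fun {κ R : Type*} [Fintype κ] [AddCommMonoid R] {n : ℕ}
    (G : (Fin (n + 1) → κ) → R) :
    ∑ α, G α = ∑ b, ∑ α : Fin n → κ, G (Fin.cons b α) := by
  rw [← (Fin.consEquiv fun _ => κ).sum_comp, Fintype.sum_prod_type]
  rfl

/-- Sum over multi-indices with entries at most two, weighted by a function of the total degree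
that is supported on degrees at most two. -/
theorem sum_multiIndex_weight {n : ℕ} (f : Fin n → Fin 3 → ℝ) (hf : ∀ i, f i 0 = 1) (F : ℕ → ℝ)
    (hF : ∀ k, 2 < k → F k = 0) :
    ∑ α : Fin n → Fin 3, F (∑ i, (α i : ℕ)) * ∏ i, f i (α i) =
      F 0 + F 1 * ∑ i, f i 1 +
        F 2 * (∑ i, f i 2 + ((∑ i, f i 1) ^ 2 - ∑ i, f i 1 ^ 2) / 2) := by
  induction n generalizing F with
  | zero => simp
  | succ n ih =>
    have h := fun F hF => ih (fun i => f i.succ) (fun i => hf _) F hF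
    rw [Fin.sum_fin_succ_fun]
    simp only [Fin.sum_univ_succ (n := n), Fin.prod_univ_succ (n := n), Fin.cons_zero,
      Fin.cons_succ]
    have h0 := h F hF
    have h1 := h (fun k => F (1 + k)) (fun k hk => hF _ (by omega))
    have h2 := h (fun k => F (2 + k)) (fun k hk => hF _ (by omega))
    have e : ∀ b : Fin 3, ∑ α : Fin n → Fin 3, F (b + ∑ i, (α i : ℕ)) *
        (f 0 b * ∏ i, f i.succ (α i)) =
        f 0 b * ∑ α : Fin n → Fin 3, F (b + ∑ i, (α i : ℕ)) * ∏ i, f i.succ (α i) := by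
      intro b; rw [Finset.mul_sum]; exact Finset.sum_congr rfl fun α _ => by ring
    simp_rw [e]
    rw [Fin.sum_univ_three]
    simp only [Fin.val_zero, Fin.val_one, Fin.val_two, zero_add]
    rw [h0, h1, h2, hf 0]
    simp only [hF 3 (by norm_num), hF 4 (by norm_num), add_zero, Nat.reduceAdd]
    ring

/-- Sum over pairs of multi-indices for weights supported on pairs of equal parity. -/
theorem sum_multiIndex_pair_weight {n : ℕ} (f : Fin n → Fin 3 → Fin 3 → ℝ)
    (h00 : ∀ i, f i 0 0 = 1) (h01 : ∀ i, f i 0 1 = 0) (h10 : ∀ i, f i 1 0 = 0)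
    (h12 : ∀ i, f i 1 2 = 0) (h21 : ∀ i, f i 2 1 = 0) (F : ℕ → ℕ → ℝ)
    (hF : ∀ k l, 2 < k → F k l = 0) (hF' : ∀ k l, 2 < l → F k l = 0) :
    ∑ α : Fin n → Fin 3, ∑ β : Fin n → Fin 3, F (∑ i, (α i : ℕ)) (∑ i, (β i : ℕ)) *
        ∏ i, f i (α i) (β i) =
      F 0 0 + F 1 1 * ∑ i, f i 1 1 + F 0 2 * ∑ i, f i 0 2 + F 2 0 * ∑ i, f i 2 0 +
        F 2 2 * (∑ i, f i 2 2 + ((∑ i, f i 0 2) * (∑ i, f i 2 0) - ∑ i, f i 0 2 * f i 2 0) +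
          ((∑ i, f i 1 1) ^ 2 - ∑ i, f i 1 1 ^ 2) / 2) := by
  induction n generalizing F with
  | zero => simp
  | succ n ih =>
    have h := fun F hF hF' => ih (fun i => f i.succ) (fun i => h00 _) (fun i => h01 _)
      (fun i => h10 _) (fun i => h12 _) (fun i => h21 _) F hF hF'
    rw [Fin.sum_fin_succ_fun]
    simp_rw [Fin.sum_fin_succ_fun (κ := Fin 3) (R := ℝ) (n := n)]
    simp only [Fin.sum_univ_succ (n := n), Fin.prod_univ_succ (n := n), Fin.cons_zero,
      Fin.cons_succ]
    have hs : ∀ a b : ℕ, _ := fun a b => h (fun k l => F (a + k) (b + l))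
      (fun k l hk => hF _ _ (by omega)) (fun k l hk => hF' _ _ (by omega))
    have e : ∀ a : Fin 3, ∑ α : Fin n → Fin 3, ∑ b : Fin 3, ∑ β : Fin n → Fin 3,
        F (a + ∑ i, (α i : ℕ)) (b + ∑ i, (β i : ℕ)) * (f 0 a b * ∏ i, f i.succ (α i) (β i)) =
        ∑ b : Fin 3, f 0 a b * ∑ α : Fin n → Fin 3, ∑ β : Fin n → Fin 3,
          F (a + ∑ i, (α i : ℕ)) (b + ∑ i, (β i : ℕ)) * ∏ i, f i.succ (α i) (β i) := by
      intro a; rw [Finset.sum_comm]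
      refine Finset.sum_congr rfl fun b _ => ?_
      rw [Finset.mul_sum]
      refine Finset.sum_congr rfl fun α _ => ?_
      rw [Finset.mul_sum]
      exact Finset.sum_congr rfl fun β _ => by ring
    simp_rw [e, hs]
    simp only [Fin.sum_univ_three, Fin.val_zero, Fin.val_one, Fin.val_two, zero_add, h00, h01, h10,
      h12, h21, Nat.reduceAdd, add_zero]
    simp only [hF 3 _ (by norm_num), hF 4 _ (by norm_num), hF' _ 3 (by norm_num),
      hF' _ 4 (by norm_num)]
    ring

/-- Multi-indices of total degree at most two. -/
def lowMultiIndex (n : ℕ) : Finset (Fin n → Fin 3) :=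
  Finset.univ.filter fun α => ∑ i, (α i : ℕ) ≤ 2

theorem sum_lowMultiIndex {n : ℕ} (g : Fin n → ℝ) (f : Fin n → Fin 3 → ℝ) (hf : ∀ i, f i 0 = 1) :
    ∑ α ∈ lowMultiIndex n, ∏ i, (g i * f i (α i)) =
      (∏ i, g i) * (1 + ∑ i, f i 1 + ∑ i, f i 2 + ((∑ i, f i 1) ^ 2 - ∑ i, f i 1 ^ 2) / 2) := by
  have h := sum_multiIndex_weight f hf (fun k => if k ≤ 2 then 1 else 0)
    (fun k hk => if_neg (by omega))
  simp only [ite_mul, one_mul, zero_mul, zero_le, one_le_two, le_refl, if_true] at h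
  simp_rw [Finset.prod_mul_distrib]
  rw [← Finset.mul_sum, lowMultiIndex, Finset.sum_filter, h]
  ring

theorem sum_sum_lowMultiIndex {n : ℕ} (g : Fin n → ℝ) (f : Fin n → Fin 3 → Fin 3 → ℝ)
    (h00 : ∀ i, f i 0 0 = 1) (h01 : ∀ i, f i 0 1 = 0) (h10 : ∀ i, f i 1 0 = 0)
    (h12 : ∀ i, f i 1 2 = 0) (h21 : ∀ i, f i 2 1 = 0) :
    ∑ α ∈ lowMultiIndex n, ∑ β ∈ lowMultiIndex n, ∏ i, (g i * f i (α i) (β i)) =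
      (∏ i, g i) * (1 + ∑ i, f i 1 1 + ∑ i, f i 0 2 + ∑ i, f i 2 0 + ∑ i, f i 2 2 +
        ((∑ i, f i 0 2) * (∑ i, f i 2 0) - ∑ i, f i 0 2 * f i 2 0) +
          ((∑ i, f i 1 1) ^ 2 - ∑ i, f i 1 1 ^ 2) / 2) := by
  have h := sum_multiIndex_pair_weight f h00 h01 h10 h12 h21
    (fun k l => if k ≤ 2 then (if l ≤ 2 then 1 else 0) else 0)
    (fun k l hk => if_neg (by omega)) (fun k l hl => by simp [show ¬ l ≤ 2 by omega])
  simp only [ite_mul, one_mul, zero_mul, zero_le, one_le_two, le_refl, if_true] at h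
  have e : ∀ α : Fin n → Fin 3, (∑ β : Fin n → Fin 3, if ∑ i, (α i : ℕ) ≤ 2 then
      (if ∑ i, (β i : ℕ) ≤ 2 then ∏ i, f i (α i) (β i) else 0) else 0) =
      if ∑ i, (α i : ℕ) ≤ 2 then (∑ β ∈ lowMultiIndex n, ∏ i, f i (α i) (β i)) else 0 := by
    intro α
    split_ifs
    · rw [lowMultiIndex, Finset.sum_filter]
    · simp
  simp_rw [e] at h
  rw [← Finset.sum_filter] at h
  simp_rw [Finset.prod_mul_distrib, ← Finset.mul_sum]
  rw [show (∑ α ∈ lowMultiIndex n, ∑ β ∈ lowMultiIndex n, ∏ i, f i (α i) (β i)) = _ from h]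
  ring

theorem memLp_two_pi_prod {n : ℕ} {f : Fin n → ℝ → ℝ} {μ : Measure ℝ} [IsProbabilityMeasure μ]
    (hf : ∀ i, MemLp (f i) 2 μ) (hm : ∀ i, Measurable (f i)) :
    MemLp (fun x : Fin n → ℝ => ∏ i, f i (x i)) 2 (Measure.pi fun _ => μ) := by
  have hmeas : Measurable (fun x : Fin n → ℝ => ∏ i, f i (x i)) :=
    Finset.measurable_prod _ fun i _ => (hm i).comp (measurable_pi_apply i)
  rw [memLp_two_iff_integrable_sq hmeas.aestronglyMeasurable]
  simp_rw [← Finset.prod_pow]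
  exact Integrable.fintype_prod fun i => (hf i).integrable_sq

/-- The projection of the Gaussian kernel onto quadratic polynomials in the second variable, in
standardized diagonal coordinates. -/
noncomputable def diagProj {n : ℕ} (a : Fin n → ℝ) (u v : Fin n → ℝ) : ℝ :=
  (∏ i, (1 + 2 * a i)) ^ (-(1 : ℝ) / 2) * rexp (-∑ i, a i / (1 + 2 * a i) * u i ^ 2) *
    (1 + 2 * ∑ i, a i / (1 + 2 * a i) * u i * v i +
      2 * (∑ i, a i / (1 + 2 * a i) * u i * v i) ^ 2
      - 2 * ∑ i, (a i / (1 + 2 * a i)) ^ 2 * u i ^ 2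
      - ∑ i, a i / (1 + 2 * a i) * v i ^ 2 + ∑ i, a i / (1 + 2 * a i))

/-- The projection of the Gaussian kernel onto quadratic polynomials in both variables, in
standardized diagonal coordinates. -/
noncomputable def diagProj₂ {n : ℕ} (a : Fin n → ℝ) (u v : Fin n → ℝ) : ℝ :=
  (∏ i, (1 + 4 * a i)) ^ (-(1 : ℝ) / 2) *
    (1 + 2 * ∑ i, a i / (1 + 4 * a i) * u i * v i - ∑ i, a i / (1 + 4 * a i) * (u i ^ 2 - 1)
      - ∑ i, a i / (1 + 4 * a i) * (v i ^ 2 - 1) +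
      (∑ i, a i / (1 + 4 * a i) * (u i ^ 2 - 1)) * (∑ i, a i / (1 + 4 * a i) * (v i ^ 2 - 1)) +
      2 * ((∑ i, a i / (1 + 4 * a i) * u i * v i) ^ 2
        - ∑ i, (a i / (1 + 4 * a i)) ^ 2 * u i ^ 2
        - ∑ i, (a i / (1 + 4 * a i)) ^ 2 * v i ^ 2 + ∑ i, (a i / (1 + 4 * a i)) ^ 2))

theorem sum_prod_hermiteCoeff_mul_hermiteN {n : ℕ} {a : Fin n → ℝ} (ha : ∀ i, 0 ≤ a i)
    (u v : Fin n → ℝ) :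
    ∑ α ∈ lowMultiIndex n, (∏ i, hermiteCoeff (a i) (α i) (u i)) * ∏ i, hermiteN (α i) (v i) =
      diagProj a u v := by
  have h2 : √2 * √2 = 2 := Real.mul_self_sqrt (by norm_num)
  have h := sum_lowMultiIndex
    (fun i => (1 + 2 * a i) ^ (-(1 : ℝ) / 2) * rexp (-(a i / (1 + 2 * a i)) * u i ^ 2))
    (fun i k => ![1, 2 * (a i / (1 + 2 * a i)) * u i,
      (4 * (a i / (1 + 2 * a i)) ^ 2 * u i ^ 2 - 2 * (a i / (1 + 2 * a i))) / √2] k *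
        hermiteN k (v i)) (fun i => by simp [hermiteN])
  simp_rw [← Finset.prod_mul_distrib, hermiteCoeff, mul_assoc] at h ⊢
  rw [h, diagProj, Finset.prod_mul_distrib, ← Real.exp_sum,
    Real.finsetProd_rpow _ _ fun i _ => by linarith [ha i], ← Finset.sum_neg_distrib]
  simp only [neg_mul, mul_assoc]
  congr 2
  simp only [hermiteN, Matrix.cons_val_zero, Matrix.cons_val_one, Matrix.cons_val]
  simp only [mul_assoc]
  have e1 : ∑ i, 2 * (a i / (1 + 2 * a i) * (u i * v i)) =
    2 * ∑ i, a i / (1 + 2 * a i) * (u i * v i) := by rw [Finset.mul_sum]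
  have e2 : ∑ i, (4 * ((a i / (1 + 2 * a i)) ^ 2 * u i ^ 2) - 2 * (a i / (1 + 2 * a i))) / √2 *
      ((v i ^ 2 - 1) / √2) = 2 * ∑ i, (a i / (1 + 2 * a i)) ^ 2 * (u i ^ 2 * v i ^ 2)
      - 2 * ∑ i, (a i / (1 + 2 * a i)) ^ 2 * u i ^ 2
      - ∑ i, a i / (1 + 2 * a i) * v i ^ 2 + ∑ i, a i / (1 + 2 * a i) := by
    simp_rw [Finset.mul_sum, ← Finset.sum_sub_distrib, ← Finset.sum_add_distrib]
    refine Finset.sum_congr rfl fun i _ => ?_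
    rw [div_mul_div_comm, h2]; ring
  have e3 : ∑ i, (2 * (a i / (1 + 2 * a i) * (u i * v i))) ^ 2 =
      4 * ∑ i, (a i / (1 + 2 * a i)) ^ 2 * (u i ^ 2 * v i ^ 2) := by
    rw [Finset.mul_sum]; exact Finset.sum_congr rfl fun i _ => by ring
  rw [e1, e2, e3]
  ring

theorem sum_sum_lowMultiIndex_of_eq {n : ℕ} (g : Fin n → ℝ) (f : Fin n → Fin 3 → Fin 3 → ℝ)
    (h00 : ∀ i, f i 0 0 = 1) (h01 : ∀ i, f i 0 1 = 0) (h10 : ∀ i, f i 1 0 = 0)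
    (h12 : ∀ i, f i 1 2 = 0) (h21 : ∀ i, f i 2 1 = 0) {c₁₁ c₀₂ c₂₀ c₂₂ : Fin n → ℝ}
    (h11 : ∀ i, f i 1 1 = c₁₁ i) (h02 : ∀ i, f i 0 2 = c₀₂ i) (h20 : ∀ i, f i 2 0 = c₂₀ i)
    (h22 : ∀ i, f i 2 2 = c₂₂ i) :
    ∑ α ∈ lowMultiIndex n, ∑ β ∈ lowMultiIndex n, ∏ i, (g i * f i (α i) (β i)) =
      (∏ i, g i) * (1 + ∑ i, c₁₁ i + ∑ i, c₀₂ i + ∑ i, c₂₀ i + ∑ i, c₂₂ i +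
        ((∑ i, c₀₂ i) * (∑ i, c₂₀ i) - ∑ i, c₀₂ i * c₂₀ i) +
          ((∑ i, c₁₁ i) ^ 2 - ∑ i, c₁₁ i ^ 2) / 2) := by
  rw [sum_sum_lowMultiIndex g f h00 h01 h10 h12 h21]
  simp_rw [h11, h02, h20, h22]

theorem sum_sum_prod_hermiteCoeff₂_mul {n : ℕ} {a : Fin n → ℝ} (ha : ∀ i, 0 ≤ a i)
    (u v : Fin n → ℝ) :
    ∑ α ∈ lowMultiIndex n, ∑ β ∈ lowMultiIndex n, (∏ i, hermiteCoeff₂ (a i) (α i) (β i)) *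
      ((∏ i, hermiteN (α i) (u i)) * ∏ i, hermiteN (β i) (v i)) = diagProj₂ a u v := by
  have h2 : √2 * √2 = 2 := Real.mul_self_sqrt (by norm_num)
  simp_rw [← Finset.prod_mul_distrib, hermiteCoeff₂, mul_assoc ((1 + 4 * a _) ^ (-(1 : ℝ) / 2))]
  generalize hr : (fun i => a i / (1 + 4 * a i)) = r
  have hri : ∀ i, a i / (1 + 4 * a i) = r i := congrFun hr
  rw [sum_sum_lowMultiIndex_of_eq (fun i => (1 + 4 * a i) ^ (-(1 : ℝ) / 2))
    (fun i k l => !![1, 0, -2 * (a i / (1 + 4 * a i)) / √2; 0, 2 * (a i / (1 + 4 * a i)), 0;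
      -2 * (a i / (1 + 4 * a i)) / √2, 0, 6 * (a i / (1 + 4 * a i)) ^ 2] k l *
        (hermiteN k (u i) * hermiteN l (v i)))
    (fun i => by simp [hermiteN]) (fun i => by simp) (fun i => by simp) (fun i => by simp)
    (fun i => by simp) (c₁₁ := fun i => 2 * (r i * u i * v i))
    (c₀₂ := fun i => -(r i * (v i ^ 2 - 1))) (c₂₀ := fun i => -(r i * (u i ^ 2 - 1)))
    (c₂₂ := fun i => 3 * (r i ^ 2 * ((u i ^ 2 - 1) * (v i ^ 2 - 1))))
    (fun i => by simp [hermiteN, hri]; ring)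
    (fun i => by simp [hermiteN, hri]; rw [div_mul_div_comm, h2]; ring)
    (fun i => by simp [hermiteN, hri]; rw [div_mul_div_comm, h2]; ring)
    (fun i => by simp [hermiteN, hri]; rw [div_mul_div_comm, h2]; ring),
    diagProj₂, Real.finsetProd_rpow _ _ fun i _ => by linarith [ha i]]
  congr 1
  simp only [hri, Finset.sum_neg_distrib, ← Finset.mul_sum]
  have e1 : ∑ i, -(r i * (v i ^ 2 - 1)) * -(r i * (u i ^ 2 - 1)) =
      ∑ i, r i ^ 2 * ((u i ^ 2 - 1) * (v i ^ 2 - 1)) :=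
    Finset.sum_congr rfl fun i _ => by ring
  have e2 : ∑ i, (2 * (r i * u i * v i)) ^ 2 = 4 * (∑ i, r i ^ 2 * ((u i ^ 2 - 1) * (v i ^ 2 - 1))
      + ∑ i, r i ^ 2 * u i ^ 2 + ∑ i, r i ^ 2 * v i ^ 2 - ∑ i, r i ^ 2) := by
    rw [← Finset.sum_add_distrib, ← Finset.sum_add_distrib, ← Finset.sum_sub_distrib,
      Finset.mul_sum]
    exact Finset.sum_congr rfl fun i _ => by ring
  rw [e1, e2]
  ring

theorem sum_integral_prod_hermiteCoeff_sq {n : ℕ} {a : Fin n → ℝ} (ha : ∀ i, 0 ≤ a i) :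
    ∑ α ∈ lowMultiIndex n, ∫ u : Fin n → ℝ, (∏ i, hermiteCoeff (a i) (α i) (u i)) ^ 2
        ∂(Measure.pi fun _ => gaussianReal 0 1) =
      (∏ i, (1 + 2 * a i)) ^ (-(1 : ℝ) / 2) * (∏ i, (1 + 6 * a i)) ^ (-(1 : ℝ) / 2) *
      (1 + 1 / 2 * (∑ i, a i / (1 + 2 * a i)) ^ 2 + ∑ i, (a i / (1 + 2 * a i)) ^ 2 +
        1 / 2 * (∑ i, a i / (1 + 6 * a i)) ^ 2 + ∑ i, (a i / (1 + 6 * a i)) ^ 2 +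
        ∑ i, a i / (1 + 2 * a i) - ∑ i, a i / (1 + 6 * a i) -
        (∑ i, a i / (1 + 2 * a i)) * ∑ i, a i / (1 + 6 * a i)) := by
  simp_rw [← Finset.prod_pow]
  have e : ∀ α : Fin n → Fin 3, ∫ u : Fin n → ℝ, ∏ i, hermiteCoeff (a i) (α i) (u i) ^ 2
      ∂(Measure.pi fun _ => gaussianReal 0 1) =
      ∏ i, ∫ x, hermiteCoeff (a i) (α i) x ^ 2 ∂(gaussianReal 0 1) := fun α =>
    integral_fintype_prod_eq_prod (fun i x => hermiteCoeff (a i) (α i) x ^ 2)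
  simp_rw [e, integral_hermiteCoeff_sq (ha _)]
  rw [sum_lowMultiIndex (fun i => (1 + 2 * a i) ^ (-(1 : ℝ) / 2) * (1 + 6 * a i) ^ (-(1 : ℝ) / 2))
    (fun i k => ![1, a i / (1 + 2 * a i) - a i / (1 + 6 * a i),
          3 / 2 * (a i / (1 + 2 * a i)) ^ 2 - a i / (1 + 2 * a i) * (a i / (1 + 6 * a i)) +
            3 / 2 * (a i / (1 + 6 * a i)) ^ 2] k) (fun i => rfl), Finset.prod_mul_distrib,
    Real.finsetProd_rpow _ _ fun i _ => by linarith [ha i],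
    Real.finsetProd_rpow _ _ fun i _ => by linarith [ha i]]
  congr 1
  simp only [Matrix.cons_val_one, Matrix.cons_val_zero, Matrix.cons_val, sub_sq,
    Finset.sum_add_distrib, Finset.sum_sub_distrib, ← Finset.mul_sum, mul_assoc]
  ring

theorem sum_sum_prod_hermiteCoeff₂_sq {n : ℕ} {a : Fin n → ℝ} (ha : ∀ i, 0 ≤ a i) :
    ∑ α ∈ lowMultiIndex n, ∑ β ∈ lowMultiIndex n,
        (∏ i, hermiteCoeff₂ (a i) (α i) (β i)) ^ 2 =
      (∏ i, (1 + 4 * a i))⁻¹ * (1 + 8 * ∑ i, (a i / (1 + 4 * a i)) ^ 2 +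
        12 * (∑ i, (a i / (1 + 4 * a i)) ^ 2) ^ 2 + 24 * ∑ i, (a i / (1 + 4 * a i)) ^ 4) := by
  have h2 : √2 ^ 2 = 2 := Real.sq_sqrt (by norm_num)
  have e : ∀ i, ((1 + 4 * a i) ^ (-(1 : ℝ) / 2)) ^ 2 = (1 + 4 * a i)⁻¹ := by
    intro i
    have : 0 ≤ 1 + 4 * a i := by linarith [ha i]
    rw [← Real.rpow_natCast, ← Real.rpow_mul this, ← Real.rpow_neg_one]; norm_num
  simp_rw [← Finset.prod_pow, hermiteCoeff₂, mul_pow ((1 + 4 * a _) ^ (-(1 : ℝ) / 2)), e]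
  rw [sum_sum_lowMultiIndex_of_eq (fun i => (1 + 4 * a i)⁻¹)
    (fun i k l => !![1, 0, -2 * (a i / (1 + 4 * a i)) / √2; 0, 2 * (a i / (1 + 4 * a i)), 0;
      -2 * (a i / (1 + 4 * a i)) / √2, 0, 6 * (a i / (1 + 4 * a i)) ^ 2] k l ^ 2)
    (fun i => by simp) (fun i => by simp) (fun i => by simp) (fun i => by simp)
    (fun i => by simp) (c₁₁ := fun i => 4 * (a i / (1 + 4 * a i)) ^ 2)
    (c₀₂ := fun i => 2 * (a i / (1 + 4 * a i)) ^ 2) (c₂₀ := fun i => 2 * (a i / (1 + 4 * a i)) ^ 2)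
    (c₂₂ := fun i => 36 * (a i / (1 + 4 * a i)) ^ 4)
    (fun i => by simp; ring) (fun i => by simp; rw [div_pow _ √2, h2]; ring)
    (fun i => by simp; rw [div_pow _ √2, h2]; ring) (fun i => by simp; ring),
    Finset.prod_inv_distrib]
  congr 1
  have e1 : ∑ i, 2 * (a i / (1 + 4 * a i)) ^ 2 * (2 * (a i / (1 + 4 * a i)) ^ 2) =
      4 * ∑ i, (a i / (1 + 4 * a i)) ^ 4 := by
    rw [Finset.mul_sum]; exact Finset.sum_congr rfl fun i _ => by ring
  have e2 : ∑ i, (4 * (a i / (1 + 4 * a i)) ^ 2) ^ 2 =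
      16 * ∑ i, (a i / (1 + 4 * a i)) ^ 4 := by
    rw [Finset.mul_sum]; exact Finset.sum_congr rfl fun i _ => by ring
  simp only [e1, e2, ← Finset.mul_sum]
  ring

theorem integral_sq_gaussianKernel_sub_diagProj {n : ℕ} {a : Fin n → ℝ} (ha : ∀ i, 0 ≤ a i) :
    ∫ v : Fin n → ℝ, ∫ u : Fin n → ℝ,
        (rexp (-∑ i, a i * (u i - v i) ^ 2) - diagProj a u v - diagProj a v u
          + diagProj₂ a u v) ^ 2
          ∂(Measure.pi fun _ => gaussianReal 0 1) ∂(Measure.pi fun _ => gaussianReal 0 1) =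
      (∏ i, (1 + 8 * a i)) ^ (-(1 : ℝ) / 2)
      - 2 * ((∏ i, (1 + 2 * a i)) ^ (-(1 : ℝ) / 2) * (∏ i, (1 + 6 * a i)) ^ (-(1 : ℝ) / 2) *
      (1 + 1 / 2 * (∑ i, a i / (1 + 2 * a i)) ^ 2 + ∑ i, (a i / (1 + 2 * a i)) ^ 2 +
        1 / 2 * (∑ i, a i / (1 + 6 * a i)) ^ 2 + ∑ i, (a i / (1 + 6 * a i)) ^ 2 +
        ∑ i, a i / (1 + 2 * a i) - ∑ i, a i / (1 + 6 * a i) -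
        (∑ i, a i / (1 + 2 * a i)) * ∑ i, a i / (1 + 6 * a i)))
      + (∏ i, (1 + 4 * a i))⁻¹ * (1 + 8 * ∑ i, (a i / (1 + 4 * a i)) ^ 2 +
        12 * (∑ i, (a i / (1 + 4 * a i)) ^ 2) ^ 2 + 24 * ∑ i, (a i / (1 + 4 * a i)) ^ 4) := by
  have hexp : ∀ u v : Fin n → ℝ, rexp (-∑ i, a i * (u i - v i) ^ 2) =
      ∏ i, rexp (-a i * (u i - v i) ^ 2) := by
    intro u v
    rw [← Real.exp_sum, ← Finset.sum_neg_distrib]; simp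
  have hpi : ∀ f : Fin n → ℝ → ℝ, ∫ u : Fin n → ℝ, ∏ i, f i (u i)
      ∂(Measure.pi fun _ => gaussianReal 0 1) = ∏ i, ∫ x, f i x ∂(gaussianReal 0 1) := fun f =>
    integral_fintype_prod_eq_prod f
  have key := integral_sq_kernel_sub_projections (Measure.pi fun _ : Fin n => gaussianReal 0 1)
    (lowMultiIndex n) (fun u v => rexp (-∑ i, a i * (u i - v i) ^ 2)) ?_ ?_
    (fun α u => ∏ i, hermiteCoeff (a i) (α i) (u i)) (fun α u => ∏ i, hermiteN (α i) (u i))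
    (fun α => memLp_two_pi_prod (fun i => memLp_hermiteCoeff (ha i) _)
      fun i => measurable_hermiteCoeff _ _)
    (fun α => memLp_two_pi_prod (fun i => memLp_hermiteN _) fun i => measurable_hermiteN _)
    ?_ ?_ (fun α β => ∏ i, hermiteCoeff₂ (a i) (α i) (β i)) ?_
  · have e1 : ∀ u v : Fin n → ℝ, ∑ α ∈ lowMultiIndex n,
        (∏ i, hermiteN (α i) (u i)) * (∏ i, hermiteCoeff (a i) (α i) (v i)) = diagProj a v u := by
      intro u v
      rw [← sum_prod_hermiteCoeff_mul_hermiteN ha]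
      exact Finset.sum_congr rfl fun _ _ => mul_comm _ _
    have e2 : ∫ u : Fin n → ℝ, ∫ v : Fin n → ℝ, rexp (-∑ i, a i * (u i - v i) ^ 2) ^ 2
        ∂(Measure.pi fun _ => gaussianReal 0 1) ∂(Measure.pi fun _ => gaussianReal 0 1) =
        (∏ i, (1 + 8 * a i)) ^ (-(1 : ℝ) / 2) := by
      simp_rw [hexp, ← Finset.prod_pow]
      have : ∀ u : Fin n → ℝ, _ := fun u => hpi fun i x => rexp (-a i * (u i - x) ^ 2) ^ 2
      simp_rw [this]
      rw [hpi fun i x => ∫ y, rexp (-a i * (x - y) ^ 2) ^ 2 ∂(gaussianReal 0 1)]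
      simp_rw [integral_integral_exp_neg_sq_sq (ha _)]
      exact Real.finsetProd_rpow _ _ (fun i _ => by linarith [ha i]) _
    simp_rw [sum_prod_hermiteCoeff_mul_hermiteN ha, e1, sum_sum_prod_hermiteCoeff₂_mul ha, e2,
      sum_integral_prod_hermiteCoeff_sq ha, sum_sum_prod_hermiteCoeff₂_sq ha] at key
    exact key
  · refine MemLp.of_bound (C := 1) (by fun_prop) ?_
    refine Filter.Eventually.of_forall fun z => ?_
    rw [Real.norm_eq_abs, Real.abs_exp, Real.exp_le_one_iff, neg_nonpos]
    exact Finset.sum_nonneg fun i _ => mul_nonneg (ha i) (sq_nonneg _)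
  · intro u v
    simp_rw [sub_sq_comm]
  · intro α β
    simp_rw [← Finset.prod_mul_distrib]
    rw [hpi fun i x => hermiteN (α i) x * hermiteN (β i) x]
    simp_rw [integral_hermiteN_mul, Finset.prod_ite_zero, funext_iff]
    simp
  · intro α u
    simp_rw [hexp, ← Finset.prod_mul_distrib]
    rw [hpi fun i x => rexp (-a i * (u i - x) ^ 2) * hermiteN (α i) x]
    simp_rw [integral_exp_neg_sq_mul_hermiteN (ha _)]
  · intro α β
    simp_rw [← Finset.prod_mul_distrib]
    rw [hpi fun i x => hermiteCoeff (a i) (α i) x * hermiteN (β i) x]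
    simp_rw [integral_hermiteCoeff_mul_hermiteN (ha _)]

theorem pi_gaussianReal_eq_withDensity (n : ℕ) :
    (Measure.pi fun _ : Fin n => gaussianReal 0 1) = volume.withDensity fun u =>
      ENNReal.ofReal ((2 * π) ^ (-(n : ℝ) / 2) * rexp (-(u ⬝ᵥ u) / 2)) := by
  have hd : ∀ u : Fin n → ℝ, (2 * π) ^ (-(n : ℝ) / 2) * rexp (-(u ⬝ᵥ u) / 2) =
      ∏ i, gaussianPDFReal 0 1 (u i) := by
    intro u
    have h2 : (0 : ℝ) ≤ 2 * π := by positivity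
    simp only [gaussianPDFReal, Finset.prod_mul_distrib, Finset.prod_const, Finset.card_univ,
      Fintype.card_fin, ← Real.exp_sum, NNReal.coe_one, mul_one, sub_zero]
    congr 1
    · rw [Real.sqrt_eq_rpow, ← Real.rpow_neg h2, ← Real.rpow_natCast, ← Real.rpow_mul h2]
      congr 1; ring
    · rw [dotProduct, ← Finset.sum_neg_distrib, Finset.sum_div]
      simp_rw [sq]
  simp_rw [hd]
  refine Measure.pi_eq fun s hs => ?_
  have hint : Integrable fun u : Fin n → ℝ => ∏ i, gaussianPDFReal 0 1 (u i) :=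
    Integrable.fintype_prod fun i => integrable_gaussianPDFReal 0 1
  have h0 : ∀ u : Fin n → ℝ, 0 ≤ ∏ i, gaussianPDFReal 0 1 (u i) := fun u =>
    Finset.prod_nonneg fun i _ => gaussianPDFReal_nonneg 0 1 _
  have hS : MeasurableSet (Set.univ.pi s) := MeasurableSet.univ_pi hs
  rw [withDensity_apply _ hS, ← ofReal_integral_eq_lintegral_ofReal hint.integrableOn
    (Filter.Eventually.of_forall h0)]
  simp_rw [gaussianReal_apply_eq_integral _ one_ne_zero]
  rw [← ENNReal.ofReal_prod_of_nonneg fun i _ =>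
    integral_nonneg fun x => gaussianPDFReal_nonneg 0 1 x]
  congr 1
  rw [← integral_indicator hS]
  simp_rw [← integral_indicator (hs _)]
  rw [← integral_fintype_prod_volume_eq_prod]
  congr 1
  ext u
  by_cases hu : u ∈ Set.univ.pi s
  · rw [Set.indicator_of_mem hu]
    exact Finset.prod_congr rfl fun i _ => (Set.indicator_of_mem (hu i trivial) _).symm
  · rw [Set.indicator_of_notMem hu]
    simp only [Set.mem_pi, Set.mem_univ, true_imp_iff, not_forall] at hu
    obtain ⟨i, hi⟩ := hu
    exact (Finset.prod_eq_zero (Finset.mem_univ i) (Set.indicator_of_notMem hi _)).symm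

theorem gaussN_eq_map {d : ℕ} (m : Fin d → ℝ) {S A : Matrix (Fin d) (Fin d) ℝ}
    (hA : A.det ≠ 0) (hS : S = A * Aᵀ) :
    gaussN m S = (Measure.pi fun _ => gaussianReal 0 1).map fun u => m + A *ᵥ u := by
  have hmeas : Measurable fun u : Fin d → ℝ => m + A *ᵥ u := by fun_prop
  have hu : IsUnit A.det := isUnit_iff_ne_zero.2 hA
  have hvol : volume.map (fun u : Fin d → ℝ => m + A *ᵥ u) =
      ENNReal.ofReal |A.det⁻¹| • volume := by
    have h1 : (fun u : Fin d → ℝ => m + A *ᵥ u) = (fun x => m + x) ∘ toLin' A := rfl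
    rw [h1, ← Measure.map_map (by fun_prop) (by fun_prop),
      Real.map_matrix_volume_pi_eq_smul_volume_pi hA, Measure.map_smul, map_add_left_eq_self]
  have hdet : S.det ^ (-(1 : ℝ) / 2) = |A.det⁻¹| := by
    rw [hS, det_mul, det_transpose, ← abs_mul_abs_self, ← sq, ← Real.rpow_natCast,
      ← Real.rpow_mul (abs_nonneg _), abs_inv, ← Real.rpow_neg_one]
    norm_num
  have hquad : ∀ u : Fin d → ℝ, (m + A *ᵥ u - m) ⬝ᵥ (S⁻¹ *ᵥ (m + A *ᵥ u - m)) = u ⬝ᵥ u := by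
    intro u
    rw [add_sub_cancel_left, hS, Matrix.mul_inv_rev, mulVec_mulVec, Matrix.mul_assoc,
      nonsing_inv_mul _ hu, Matrix.mul_one, dotProduct_comm, dotProduct_mulVec, ← mulVec_transpose,
      mulVec_mulVec, mul_nonsing_inv _ (by rwa [det_transpose]), one_mulVec]
  ext s hs
  rw [Measure.map_apply hmeas hs, pi_gaussianReal_eq_withDensity, gaussN, withDensity_apply _ hs,
    withDensity_apply _ (hmeas hs)]
  have hv : (volume : Measure (Fin d → ℝ)) =
      ENNReal.ofReal |A.det| • volume.map (fun u : Fin d → ℝ => m + A *ᵥ u) := by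
    rw [hvol, smul_smul, ← ENNReal.ofReal_mul (abs_nonneg _), ← abs_mul, mul_inv_cancel₀ hA]
    simp
  conv_lhs => rw [hv]
  rw [Measure.restrict_smul, lintegral_smul_measure, setLIntegral_map hs (by fun_prop) hmeas]
  simp_rw [hquad, hdet]
  rw [smul_eq_mul, ← lintegral_const_mul _ (by fun_prop)]
  refine lintegral_congr fun u => ?_
  rw [← ENNReal.ofReal_mul (abs_nonneg _)]
  congr 1
  have : |A.det| * |A.det⁻¹| = 1 := by rw [← abs_mul, mul_inv_cancel₀ hA, abs_one]
  linear_combination ((2 * π) ^ (-(d : ℝ) / 2) * rexp (-(u ⬝ᵥ u) / 2)) * this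

theorem integral_gaussN {d : ℕ} (m : Fin d → ℝ) {S A : Matrix (Fin d) (Fin d) ℝ}
    (hA : A.det ≠ 0) (hS : S = A * Aᵀ) (f : (Fin d → ℝ) → ℝ) :
    ∫ x, f x ∂(gaussN m S) = ∫ u, f (m + A *ᵥ u) ∂(Measure.pi fun _ => gaussianReal 0 1) := by
  have hinj : Function.Injective fun u : Fin d → ℝ => m + A *ᵥ u := fun u v h =>
    Matrix.mulVec_injective_of_isUnit ((Matrix.isUnit_iff_isUnit_det A).2 (isUnit_iff_ne_zero.2 hA))
      (add_left_cancel h)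
  have hcont : Continuous fun u : Fin d → ℝ => m + A *ᵥ u := by fun_prop
  rw [gaussN_eq_map m hA hS, (hcont.measurableEmbedding hinj).integral_map]

section Algebra

variable {d : ℕ} {U : Matrix (Fin d) (Fin d) ℝ}

theorem conj_diagonal_mul_conj_diagonal (hU : Uᵀ * U = 1) (v w : Fin d → ℝ) :
    U * diagonal v * Uᵀ * (U * diagonal w * Uᵀ) = U * diagonal (fun i => v i * w i) * Uᵀ := by
  rw [← diagonal_mul_diagonal]
  calc _ = U * diagonal v * (Uᵀ * U) * diagonal w * Uᵀ := by simp only [Matrix.mul_assoc]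
    _ = _ := by rw [hU]; simp only [Matrix.mul_assoc, Matrix.one_mul]

theorem conj_diagonal_pow (hU : Uᵀ * U = 1) (w : Fin d → ℝ) (k : ℕ) :
    (U * diagonal w * Uᵀ) ^ k = U * diagonal (fun i => w i ^ k) * Uᵀ := by
  induction k with
  | zero => simp [mul_eq_one_comm.1 hU]
  | succ k ih => simp_rw [pow_succ, ih, conj_diagonal_mul_conj_diagonal hU]

theorem one_add_smul_conj_diagonal (hU : Uᵀ * U = 1) (c : ℝ) (w : Fin d → ℝ) :
    1 + c • (U * diagonal w * Uᵀ) = U * diagonal (fun i => 1 + c * w i) * Uᵀ := by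
  have : diagonal (fun i => 1 + c * w i) = (1 : Matrix (Fin d) (Fin d) ℝ) + c • diagonal w := by
    ext i j; by_cases h : i = j <;> simp [h]
  rw [this, Matrix.mul_add, Matrix.add_mul, Matrix.mul_one, mul_eq_one_comm.1 hU]
  simp

theorem det_conj_diagonal (hU : Uᵀ * U = 1) (w : Fin d → ℝ) :
    (U * diagonal w * Uᵀ).det = ∏ i, w i := by
  rw [det_mul_comm, ← Matrix.mul_assoc, hU, Matrix.one_mul, det_diagonal]

theorem trace_conj_diagonal (hU : Uᵀ * U = 1) (w : Fin d → ℝ) :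
    (U * diagonal w * Uᵀ).trace = ∑ i, w i := by
  rw [trace_mul_comm, ← Matrix.mul_assoc, hU, Matrix.one_mul, trace_diagonal]

theorem inv_conj_diagonal (hU : Uᵀ * U = 1) {w : Fin d → ℝ} (hw : ∀ i, w i ≠ 0) :
    (U * diagonal w * Uᵀ)⁻¹ = U * diagonal (fun i => (w i)⁻¹) * Uᵀ := by
  refine Matrix.inv_eq_right_inv ?_
  simp_rw [conj_diagonal_mul_conj_diagonal hU, mul_inv_cancel₀ (hw _)]
  simp [mul_eq_one_comm.1 hU]

theorem dotProduct_conj_diagonal (hU : Uᵀ * U = 1) (s w u v : Fin d → ℝ) :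
    ((U * diagonal s) *ᵥ u) ⬝ᵥ ((U * diagonal w * Uᵀ) *ᵥ ((U * diagonal s) *ᵥ v)) =
      ∑ i, w i * s i ^ 2 * u i * v i := by
  have h : (U * diagonal w * Uᵀ * (U * diagonal s))ᵀ * (U * diagonal s) =
      diagonal fun i => w i * s i ^ 2 := by
    calc _ = diagonal s * (Uᵀ * U) * diagonal w * (Uᵀ * U) * diagonal s := by
          simp only [Matrix.mul_assoc, transpose_mul, diagonal_transpose, transpose_transpose]
      _ = _ := by
          rw [hU]; simp only [Matrix.mul_one, diagonal_mul_diagonal]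
          congr 1; ext i; ring
  rw [mulVec_mulVec, dotProduct_mulVec, ← mulVec_transpose, mulVec_mulVec, h]
  simp [dotProduct, mulVec_diagonal]

theorem Matrix.IsSymm.dotProduct_mulVec_comm {P : Matrix (Fin d) (Fin d) ℝ} (hP : P.IsSymm)
    (x y : Fin d → ℝ) : y ⬝ᵥ (P *ᵥ x) = x ⬝ᵥ (P *ᵥ y) := by
  rw [dotProduct_mulVec, ← mulVec_transpose, hP.eq, dotProduct_comm]

theorem trace_mul_vecMulVec (P : Matrix (Fin d) (Fin d) ℝ) (x y : Fin d → ℝ) :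
    (P * vecMulVec x y).trace = y ⬝ᵥ (P *ᵥ x) := by
  rw [mul_vecMulVec, trace_vecMulVec, dotProduct_comm]

theorem vecMulVec_mul_mul_vecMulVec (P : Matrix (Fin d) (Fin d) ℝ) (x y z w : Fin d → ℝ) :
    vecMulVec x y * P * vecMulVec z w = (y ⬝ᵥ (P *ᵥ z)) • vecMulVec x w := by
  rw [Matrix.mul_assoc, mul_vecMulVec, vecMulVec_mul_vecMulVec, vecMulVec_smul]

theorem trace_quadratic_right {P : Matrix (Fin d) (Fin d) ℝ} (hP : P.IsSymm)
    (S : Matrix (Fin d) (Fin d) ℝ) (c : ℝ) (x y : Fin d → ℝ) :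
    (P * (c • vecMulVec x x * P - 1) * (vecMulVec y y - S)).trace =
      c * (x ⬝ᵥ (P *ᵥ y)) ^ 2 - c * (x ⬝ᵥ ((P * S * P) *ᵥ x)) - y ⬝ᵥ (P *ᵥ y) + (P * S).trace := by
  have h : P * (c • vecMulVec x x * P - 1) * (vecMulVec y y - S) =
      c • (P * (vecMulVec x x * P * vecMulVec y y)) - c • (P * vecMulVec x x * (P * S))
        - P * vecMulVec y y + P * S := by
    simp only [Matrix.mul_sub, Matrix.sub_mul, Matrix.mul_assoc, Matrix.mul_one, smul_mul_assoc,
      mul_smul_comm]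
    abel
  rw [h, vecMulVec_mul_mul_vecMulVec]
  simp only [trace_add, trace_sub, trace_smul, mul_smul_comm, trace_mul_vecMulVec, smul_eq_mul]
  rw [trace_mul_comm (P * vecMulVec x x), ← Matrix.mul_assoc, trace_mul_vecMulVec,
    hP.dotProduct_mulVec_comm x y]
  ring

theorem trace_centered (Q S : Matrix (Fin d) (Fin d) ℝ) (x : Fin d → ℝ) :
    ((vecMulVec x x - S) * Q).trace = x ⬝ᵥ (Q *ᵥ x) - (Q * S).trace := by
  rw [trace_mul_comm, Matrix.mul_sub, trace_sub, trace_mul_vecMulVec]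

theorem trace_centered_sum {Q : Matrix (Fin d) (Fin d) ℝ} (hQ : Q.IsSymm)
    (S : Matrix (Fin d) (Fin d) ℝ) (x y : Fin d → ℝ) :
    (((2 : ℝ) • vecMulVec x y - (vecMulVec x x - S) - (vecMulVec y y - S)) * Q).trace =
      2 * (x ⬝ᵥ (Q *ᵥ y)) - (x ⬝ᵥ (Q *ᵥ x) - (Q * S).trace) -
        (y ⬝ᵥ (Q *ᵥ y) - (Q * S).trace) := by
  rw [Matrix.sub_mul, Matrix.sub_mul, trace_sub, trace_sub, trace_centered, trace_centered,
    trace_mul_comm, mul_smul_comm, trace_smul, trace_mul_vecMulVec, hQ.dotProduct_mulVec_comm,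
    smul_eq_mul]

theorem trace_centered_mul {Q : Matrix (Fin d) (Fin d) ℝ} (hQ : Q.IsSymm)
    (S : Matrix (Fin d) (Fin d) ℝ) (x y : Fin d → ℝ) :
    ((vecMulVec x x - S) * Q * (vecMulVec y y - S) * Q).trace =
      (x ⬝ᵥ (Q *ᵥ y)) ^ 2 - x ⬝ᵥ ((Q * S * Q) *ᵥ x) - y ⬝ᵥ ((Q * S * Q) *ᵥ y) +
        ((Q * S) ^ 2).trace := by
  have h : Q * ((vecMulVec x x - S) * Q * (vecMulVec y y - S)) =
      Q * (vecMulVec x x * Q * vecMulVec y y) - Q * vecMulVec x x * (Q * S)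
        - Q * S * Q * vecMulVec y y + (Q * S) ^ 2 := by
    simp only [Matrix.mul_sub, Matrix.sub_mul, Matrix.mul_assoc, sq]
    abel
  rw [trace_mul_comm, h, vecMulVec_mul_mul_vecMulVec]
  simp only [trace_add, trace_sub, trace_smul, mul_smul_comm, trace_mul_vecMulVec, smul_eq_mul]
  rw [trace_mul_comm (Q * vecMulVec x x), ← Matrix.mul_assoc, trace_mul_vecMulVec,
    hQ.dotProduct_mulVec_comm x y]
  ring

theorem isSymm_conj_diagonal (w : Fin d → ℝ) : (U * diagonal w * Uᵀ).IsSymm := by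
  simp [Matrix.IsSymm, transpose_mul, Matrix.mul_assoc]

end Algebra

theorem Matrix.PosDef.exists_conj_diagonal {d : ℕ} {S : Matrix (Fin d) (Fin d) ℝ}
    (hS : S.PosDef) : ∃ (U : Matrix (Fin d) (Fin d) ℝ) (w : Fin d → ℝ), Uᵀ * U = 1 ∧
      (∀ i, 0 < w i) ∧ S = U * diagonal w * Uᵀ := by
  refine ⟨hS.1.eigenvectorUnitary, hS.1.eigenvalues, ?_, hS.eigenvalues_pos, ?_⟩
  · exact Unitary.coe_star_mul_self hS.1.eigenvectorUnitary
  · exact hS.1.spectral_theorem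

section Resolvent

variable {d : ℕ} {U : Matrix (Fin d) (Fin d) ℝ} {w : Fin d → ℝ} {σ k : ℝ}

theorem det_one_add_smul_conj_diagonal (hU : Uᵀ * U = 1) :
    (1 + (k * σ) • (U * diagonal w * Uᵀ)).det = ∏ i, (1 + k * (σ * w i)) := by
  simp_rw [one_add_smul_conj_diagonal hU, det_conj_diagonal hU, mul_assoc]

theorem inv_one_add_smul_conj_diagonal (hU : Uᵀ * U = 1) (h : ∀ i, 0 < 1 + k * (σ * w i)) :
    (1 + (k * σ) • (U * diagonal w * Uᵀ))⁻¹ =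
      U * diagonal (fun i => (1 + k * (σ * w i))⁻¹) * Uᵀ := by
  simp_rw [one_add_smul_conj_diagonal hU, mul_assoc k]
  exact inv_conj_diagonal hU fun i => (h i).ne'

theorem isSymm_inv_one_add_smul_conj_diagonal (hU : Uᵀ * U = 1)
    (h : ∀ i, 0 < 1 + k * (σ * w i)) :
    ((1 + (k * σ) • (U * diagonal w * Uᵀ))⁻¹).IsSymm := by
  rw [inv_one_add_smul_conj_diagonal hU h]
  exact isSymm_conj_diagonal _

theorem mul_trace_resolvent (hU : Uᵀ * U = 1) (h : ∀ i, 0 < 1 + k * (σ * w i)) (j : ℕ) :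
    σ ^ j * (((1 + (k * σ) • (U * diagonal w * Uᵀ))⁻¹ * (U * diagonal w * Uᵀ)) ^ j).trace =
      ∑ i, (σ * w i / (1 + k * (σ * w i))) ^ j := by
  rw [inv_one_add_smul_conj_diagonal hU h, conj_diagonal_mul_conj_diagonal hU,
    conj_diagonal_pow hU, trace_conj_diagonal hU, Finset.mul_sum]
  exact Finset.sum_congr rfl fun i _ => by rw [← mul_pow]; congr 1; ring

theorem mul_dotProduct_resolvent (hU : Uᵀ * U = 1) (h : ∀ i, 0 < 1 + k * (σ * w i))
    (hw : ∀ i, 0 ≤ w i) (u v : Fin d → ℝ) :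
    σ * (((U * diagonal fun i => √(w i)) *ᵥ u) ⬝ᵥ
      ((1 + (k * σ) • (U * diagonal w * Uᵀ))⁻¹ *ᵥ ((U * diagonal fun i => √(w i)) *ᵥ v))) =
      ∑ i, σ * w i / (1 + k * (σ * w i)) * u i * v i := by
  rw [inv_one_add_smul_conj_diagonal hU h, dotProduct_conj_diagonal hU, Finset.mul_sum]
  exact Finset.sum_congr rfl fun i _ => by rw [Real.sq_sqrt (hw i)]; ring

theorem mul_dotProduct_resolvent_sq (hU : Uᵀ * U = 1) (h : ∀ i, 0 < 1 + k * (σ * w i))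
    (hw : ∀ i, 0 ≤ w i) (u : Fin d → ℝ) :
    σ ^ 2 * (((U * diagonal fun i => √(w i)) *ᵥ u) ⬝ᵥ
      (((1 + (k * σ) • (U * diagonal w * Uᵀ))⁻¹ * (U * diagonal w * Uᵀ) *
        (1 + (k * σ) • (U * diagonal w * Uᵀ))⁻¹) *ᵥ
          ((U * diagonal fun i => √(w i)) *ᵥ u))) =
      ∑ i, (σ * w i / (1 + k * (σ * w i))) ^ 2 * u i ^ 2 := by
  rw [inv_one_add_smul_conj_diagonal hU h, conj_diagonal_mul_conj_diagonal hU,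
    conj_diagonal_mul_conj_diagonal hU, dotProduct_conj_diagonal hU, Finset.mul_sum]
  exact Finset.sum_congr rfl fun i _ => by rw [Real.sq_sqrt (hw i)]; ring

theorem T1_diagonal (hU : Uᵀ * U = 1) (hw : ∀ i, 0 ≤ w i) (m u v : Fin d → ℝ) :
    T1 σ (m + (U * diagonal fun i => √(w i)) *ᵥ u) (m + (U * diagonal fun i => √(w i)) *ᵥ v) =
      rexp (-∑ i, σ * w i * (u i - v i) ^ 2) := by
  have h := mul_dotProduct_resolvent (k := 0) (σ := σ) hU (fun i => by simp) hw (u - v) (u - v)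
  simp only [zero_mul, zero_smul, add_zero, inv_one, one_mulVec, div_one, Pi.sub_apply] at h
  rw [T1, add_sub_add_left_eq_sub, ← mulVec_sub, neg_mul, h]
  simp_rw [sq, mul_assoc]

theorem T2_diagonal (hU : Uᵀ * U = 1) (hw : ∀ i, 0 ≤ w i) (hσ : 0 ≤ σ) (m u v : Fin d → ℝ) :
    T2 σ m (U * diagonal w * Uᵀ) (m + (U * diagonal fun i => √(w i)) *ᵥ u)
      (m + (U * diagonal fun i => √(w i)) *ᵥ v) = diagProj (fun i => σ * w i) u v := by
  have h : ∀ i, 0 < 1 + 2 * (σ * w i) := fun i => by have := mul_nonneg hσ (hw i); linarith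
  have huu := mul_dotProduct_resolvent hU h hw u u
  have huv := mul_dotProduct_resolvent hU h hw u v
  have hvv := mul_dotProduct_resolvent hU h hw v v
  have hu2 := mul_dotProduct_resolvent_sq hU h hw u
  have ht := mul_trace_resolvent hU h 1
  simp only [pow_one] at ht
  simp only [T2, Vm, Bm, add_sub_cancel_left, sub_add_cancel, diagProj]
  rw [trace_quadratic_right (isSymm_inv_one_add_smul_conj_diagonal hU h),
    det_one_add_smul_conj_diagonal hU, neg_mul, huu]
  simp only [mul_assoc (_ / _), ← sq] at huu huv hvv hu2 ht ⊢
  congr 1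
  rw [← huv, ← hvv, ← hu2, ← ht]
  ring

theorem T4_diagonal (hU : Uᵀ * U = 1) (hw : ∀ i, 0 ≤ w i) (hσ : 0 ≤ σ) (m u v : Fin d → ℝ) :
    T4 σ m (U * diagonal w * Uᵀ) (m + (U * diagonal fun i => √(w i)) *ᵥ u)
      (m + (U * diagonal fun i => √(w i)) *ᵥ v) = diagProj₂ (fun i => σ * w i) u v := by
  have h : ∀ i, 0 < 1 + 4 * (σ * w i) := fun i => by have := mul_nonneg hσ (hw i); linarith
  have hV : (2 : ℝ) • Vm σ (U * diagonal w * Uᵀ) - 1 = 1 + (4 * σ) • (U * diagonal w * Uᵀ) := by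
    rw [Vm]; module
  have huu := mul_dotProduct_resolvent hU h hw u u
  have huv := mul_dotProduct_resolvent hU h hw u v
  have hvv := mul_dotProduct_resolvent hU h hw v v
  have hu2 := mul_dotProduct_resolvent_sq hU h hw u
  have hv2 := mul_dotProduct_resolvent_sq hU h hw v
  have ht := mul_trace_resolvent hU h 1
  have ht2 := mul_trace_resolvent hU h 2
  have hQ := isSymm_inv_one_add_smul_conj_diagonal hU h
  simp only [pow_one] at ht
  simp only [T4, hV, Bm, add_sub_cancel_left, diagProj₂]
  rw [trace_centered_sum hQ, trace_centered_mul hQ, trace_centered, trace_centered,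
    det_one_add_smul_conj_diagonal hU]
  simp only [mul_assoc (_ / _), ← sq, mul_sub, mul_one, Finset.sum_sub_distrib] at huu huv hvv ht ⊢
  congr 1
  rw [← huu, ← huv, ← hvv, ← hu2, ← hv2, ← ht, ← ht2]
  ring

end Resolvent

/-- Proposition 2: explicit formula for `2 ∫∫ K(x,y)² dN(m₀,Σ₀)(x) dN(m₀,Σ₀)(y)`. -/
theorem kernel_square_double_integral {d : ℕ} (hd : 1 ≤ d) (σ : ℝ) (hσ : 0 < σ)
    (m₀ : Fin d → ℝ) (S : Matrix (Fin d) (Fin d) ℝ) (hS : S.PosDef) :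
    2 * ∫ y, (∫ x, (Kf σ m₀ S x y) ^ 2 ∂(gaussN m₀ S)) ∂(gaussN m₀ S) =
      2 * ((1 : Matrix (Fin d) (Fin d) ℝ) + (8 * σ) • S).det ^ (-(1 : ℝ) / 2)
      - 4 * (Vm σ S).det ^ (-(1 : ℝ) / 2) * (Vm σ S + (4 * σ) • S).det ^ (-(1 : ℝ) / 2) *
        (1 + (1 / 2) * σ ^ 2 * ((Vm σ S)⁻¹ * S).trace ^ 2
           + σ ^ 2 * (((Vm σ S)⁻¹ * S) ^ 2).trace
           + (1 / 2) * σ ^ 2 * ((Vm σ S + (4 * σ) • S)⁻¹ * S).trace ^ 2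
           + σ ^ 2 * (((Vm σ S + (4 * σ) • S)⁻¹ * S) ^ 2).trace
           + σ * ((Vm σ S)⁻¹ * S).trace
           - σ * ((Vm σ S + (4 * σ) • S)⁻¹ * S).trace
           - σ ^ 2 * ((Vm σ S)⁻¹ * S).trace * ((Vm σ S + (4 * σ) • S)⁻¹ * S).trace)
      + 2 * (Vm σ S + (2 * σ) • S).det⁻¹ *
        (1 + 8 * σ ^ 2 * (((Vm σ S + (2 * σ) • S)⁻¹ * S) ^ 2).trace
           + 12 * σ ^ 4 * (((Vm σ S + (2 * σ) • S)⁻¹ * S) ^ 2).trace ^ 2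
           + 24 * σ ^ 4 * (((Vm σ S + (2 * σ) • S)⁻¹ * S) ^ 4).trace) := by
  obtain ⟨U, w, hU, hw, rfl⟩ := hS.exists_conj_diagonal
  have hw0 : ∀ i, 0 ≤ w i := fun i => (hw i).le
  have ha : ∀ i, 0 ≤ σ * w i := fun i => mul_nonneg hσ.le (hw0 i)
  have hpos : ∀ k : ℝ, 0 ≤ k → ∀ i, 0 < 1 + k * (σ * w i) := fun k hk i => by
    have := mul_nonneg hk (ha i); linarith
  have hV6 : Vm σ (U * diagonal w * Uᵀ) + (4 * σ) • (U * diagonal w * Uᵀ) =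
      1 + (6 * σ) • (U * diagonal w * Uᵀ) := by rw [Vm]; module
  have hV4 : Vm σ (U * diagonal w * Uᵀ) + (2 * σ) • (U * diagonal w * Uᵀ) =
      1 + (4 * σ) • (U * diagonal w * Uᵀ) := by rw [Vm]; module
  have hA : (U * diagonal fun i => √(w i)).det ≠ 0 := by
    have hdet : Uᵀ.det * U.det = 1 := by rw [← det_mul, hU, det_one]
    rw [det_mul, det_diagonal]
    exact mul_ne_zero (right_ne_zero_of_mul_eq_one hdet)
      (Finset.prod_ne_zero_iff.2 fun i _ => (Real.sqrt_pos.2 (hw i)).ne')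
  have hSA : U * diagonal w * Uᵀ =
      (U * diagonal fun i => √(w i)) * (U * diagonal fun i => √(w i))ᵀ := by
    rw [transpose_mul, diagonal_transpose, ← Matrix.mul_assoc,
      Matrix.mul_assoc U (diagonal _) (diagonal _), diagonal_mul_diagonal]
    simp_rw [Real.mul_self_sqrt (hw0 _)]
  have t21 := mul_trace_resolvent hU (hpos 2 (by norm_num)) 1
  have t22 := mul_trace_resolvent hU (hpos 2 (by norm_num)) 2
  have t61 := mul_trace_resolvent hU (hpos 6 (by norm_num)) 1
  have t62 := mul_trace_resolvent hU (hpos 6 (by norm_num)) 2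
  have t42 := mul_trace_resolvent hU (hpos 4 (by norm_num)) 2
  have t44 := mul_trace_resolvent hU (hpos 4 (by norm_num)) 4
  simp only [pow_one] at t21 t61
  simp_rw [integral_gaussN m₀ hA hSA, Kf, T3, T1_diagonal hU hw0, T2_diagonal hU hw0 hσ.le,
    T4_diagonal hU hw0 hσ.le]
  rw [integral_sq_gaussianKernel_sub_diagProj ha, hV6, hV4, Vm]
  simp_rw [det_one_add_smul_conj_diagonal hU]
  rw [← t21, ← t22, ← t61, ← t62, ← t42, ← t44]
  ring
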